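/- (Enstrophy, long-time average bound.) Let 0<L_s<∞ and suppose ‖u₀‖_{W^{1,4}}<∞. Then every classical solution of the Boussinesq system with 0≤T₀≤1 satisfies ⟨∫₀¹ |∇ω|² dx₂⟩ ≤ L_s⁻¹·|⟨p·∂₁u₁ restricted to x₂=1⟩ + ⟨p·∂₁u₁ restricted to x₂=0⟩| + Nu·Ra^{3/2}, where ω=∂₁u₂−∂₂u₁ is the vorticity. -/

import Mathlib

noncomputable section
open MeasureTheory Filter Set
open scoped ENNReal

namespace RB

/-- A time-dependent scalar field: arguments t, x₁, x₂. -/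
abbrev TField := ℝ → ℝ → ℝ → ℝ
/-- A static scalar field: arguments x₁, x₂. -/
abbrev SField := ℝ → ℝ → ℝ

def tsmooth (f : TField) : Prop :=
  ContDiff ℝ (⊤ : ℕ∞) (fun q : ℝ × ℝ × ℝ => f q.1 q.2.1 q.2.2)
def ssmooth (f : SField) : Prop :=
  ContDiff ℝ (⊤ : ℕ∞) (fun q : ℝ × ℝ => f q.1 q.2)
def tperiodic (Γ : ℝ) (f : TField) : Prop := ∀ t x1 x2, f t (x1 + Γ) x2 = f t x1 x2
def speriodic (Γ : ℝ) (f : SField) : Prop := ∀ x1 x2, f (x1 + Γ) x2 = f x1 x2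

/-- time derivative -/
def dt (f : TField) : TField := fun t x1 x2 => deriv (fun s => f s x1 x2) t
/-- partial derivative in x₁ (time-dependent field) -/
def d1 (f : TField) : TField := fun t x1 x2 => deriv (fun y => f t y x2) x1
/-- partial derivative in x₂ (time-dependent field) -/
def d2 (f : TField) : TField := fun t x1 x2 => deriv (fun y => f t x1 y) x2
/-- partial derivative in x₁ (static field) -/
def q1 (f : SField) : SField := fun x1 x2 => deriv (fun y => f y x2) x1
/-- partial derivative in x₂ (static field) -/
def q2 (f : SField) : SField := fun x1 x2 => deriv (fun y => f x1 y) x2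

/-- Integral over Ω = [0,Γ]×[0,1]. -/
def intΩ (Γ : ℝ) (g : SField) : ℝ :=
  ∫ x1 in Ioc (0:ℝ) Γ, ∫ x2 in Ioc (0:ℝ) 1, g x1 x2

/-- Long-time horizontal average ⟨f⟩ of a quantity f(t, x₁). -/
def ltavg (Γ : ℝ) (f : ℝ → ℝ → ℝ) : ℝ :=
  limsup (fun t => (1/t) * ∫ s in Ioc (0:ℝ) t, (1/Γ) * ∫ x1 in Ioc (0:ℝ) Γ, f s x1) atTop

/-- spatial L² norm of a static scalar field over Ω -/
def sL2 (Γ : ℝ) (f : SField) : ℝ := Real.sqrt (intΩ Γ (fun x1 x2 => f x1 x2 ^ 2))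
/-- spatial L^r norm of a static scalar field over Ω -/
def sLr (Γ r : ℝ) (f : SField) : ℝ := (intΩ Γ (fun x1 x2 => |f x1 x2| ^ r)) ^ (1/r)
/-- H¹ norm of a static scalar field over Ω -/
def sH1 (Γ : ℝ) (f : SField) : ℝ :=
  Real.sqrt (intΩ Γ (fun x1 x2 => f x1 x2 ^ 2 + q1 f x1 x2 ^ 2 + q2 f x1 x2 ^ 2))

/-- A classical solution of the Boussinesq system on Ω = [0,Γ]×[0,1] with
Rayleigh number Ra, Prandtl number Pr, slip length Ls ∈ (0,∞]
(Navier-slip with friction coefficient `(Ls⁻¹).toReal`; for Ls = ∞ this is free-slip). -/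
structure Sol (Γ Ra Pr : ℝ) (Ls : ℝ≥0∞) where
  u1 : TField
  u2 : TField
  T : TField
  p : TField
  smooth_u1 : tsmooth u1
  smooth_u2 : tsmooth u2
  smooth_T : tsmooth T
  smooth_p : tsmooth p
  periodic_u1 : tperiodic Γ u1
  periodic_u2 : tperiodic Γ u2
  periodic_T : tperiodic Γ T
  periodic_p : tperiodic Γ p
  momentum1 : ∀ t x1 x2, 0 ≤ t → x2 ∈ Icc (0:ℝ) 1 →
    Pr⁻¹ * (dt u1 t x1 x2 + u1 t x1 x2 * d1 u1 t x1 x2 + u2 t x1 x2 * d2 u1 t x1 x2)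
      - (d1 (d1 u1) t x1 x2 + d2 (d2 u1) t x1 x2) + d1 p t x1 x2 = 0
  momentum2 : ∀ t x1 x2, 0 ≤ t → x2 ∈ Icc (0:ℝ) 1 →
    Pr⁻¹ * (dt u2 t x1 x2 + u1 t x1 x2 * d1 u2 t x1 x2 + u2 t x1 x2 * d2 u2 t x1 x2)
      - (d1 (d1 u2) t x1 x2 + d2 (d2 u2) t x1 x2) + d2 p t x1 x2 = Ra * T t x1 x2
  incomp : ∀ t x1 x2, 0 ≤ t → x2 ∈ Icc (0:ℝ) 1 →
    d1 u1 t x1 x2 + d2 u2 t x1 x2 = 0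
  heat : ∀ t x1 x2, 0 ≤ t → x2 ∈ Icc (0:ℝ) 1 →
    dt T t x1 x2 + u1 t x1 x2 * d1 T t x1 x2 + u2 t x1 x2 * d2 T t x1 x2
      - (d1 (d1 T) t x1 x2 + d2 (d2 T) t x1 x2) = 0
  T_bot : ∀ t x1, 0 ≤ t → T t x1 0 = 1
  T_top : ∀ t x1, 0 ≤ t → T t x1 1 = 0
  u2_bot : ∀ t x1, 0 ≤ t → u2 t x1 0 = 0
  u2_top : ∀ t x1, 0 ≤ t → u2 t x1 1 = 0
  slip_top : ∀ t x1, 0 ≤ t → d2 u1 t x1 1 = -(Ls⁻¹).toReal * u1 t x1 1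
  slip_bot : ∀ t x1, 0 ≤ t → d2 u1 t x1 0 = (Ls⁻¹).toReal * u1 t x1 0

variable {Γ Ra Pr : ℝ} {Ls : ℝ≥0∞}

/-- The Nusselt number Nu = ⟨∫₀¹ (u₂T − ∂₂T) dx₂⟩. -/
def Nu (S : Sol Γ Ra Pr Ls) : ℝ :=
  ltavg Γ (fun t x1 => ∫ x2 in (0:ℝ)..1, (S.u2 t x1 x2 * S.T t x1 x2 - d2 S.T t x1 x2))

/-- The initial temperature satisfies 0 ≤ T₀ ≤ 1 on Ω. -/
def T0cond (S : Sol Γ Ra Pr Ls) : Prop :=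
  ∀ x1 x2, x2 ∈ Icc (0:ℝ) 1 → S.T 0 x1 x2 ∈ Icc (0:ℝ) 1

/-- The vorticity ω = ∂₁u₂ − ∂₂u₁. -/
def vort (S : Sol Γ Ra Pr Ls) : TField :=
  fun t x1 x2 => d1 S.u2 t x1 x2 - d2 S.u1 t x1 x2

/-- |∇u|² pointwise. -/
def gradSq (S : Sol Γ Ra Pr Ls) : TField := fun t x1 x2 =>
  d1 S.u1 t x1 x2 ^ 2 + d2 S.u1 t x1 x2 ^ 2 + d1 S.u2 t x1 x2 ^ 2 + d2 S.u2 t x1 x2 ^ 2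

/-- |∇²u|² pointwise: sum of squares of all second spatial derivatives of u. -/
def hessSq (S : Sol Γ Ra Pr Ls) : TField := fun t x1 x2 =>
  d1 (d1 S.u1) t x1 x2 ^ 2 + d1 (d2 S.u1) t x1 x2 ^ 2 +
  d2 (d1 S.u1) t x1 x2 ^ 2 + d2 (d2 S.u1) t x1 x2 ^ 2 +
  d1 (d1 S.u2) t x1 x2 ^ 2 + d1 (d2 S.u2) t x1 x2 ^ 2 +
  d2 (d1 S.u2) t x1 x2 ^ 2 + d2 (d2 S.u2) t x1 x2 ^ 2

/-- ‖u(t)‖_{L²}. -/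
def uL2 (S : Sol Γ Ra Pr Ls) (t : ℝ) : ℝ :=
  Real.sqrt (intΩ Γ (fun x1 x2 => S.u1 t x1 x2 ^ 2 + S.u2 t x1 x2 ^ 2))

/-- ‖u₀‖_{W^{1,4}}. -/
def W14u0 (S : Sol Γ Ra Pr Ls) : ℝ :=
  (intΩ Γ (fun x1 x2 =>
    (S.u1 0 x1 x2 ^ 2 + S.u2 0 x1 x2 ^ 2) ^ 2 + (gradSq S 0 x1 x2) ^ 2)) ^ ((1:ℝ)/4)

/-- ‖ω(t)‖_{L⁴}. -/
def omegaL4 (S : Sol Γ Ra Pr Ls) (t : ℝ) : ℝ :=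
  (intΩ Γ (fun x1 x2 => vort S t x1 x2 ^ 4)) ^ ((1:ℝ)/4)


section
/-! ### Smooth fields -/

def unc (f : TField) : ℝ × ℝ × ℝ → ℝ := fun q => f q.1 q.2.1 q.2.2

def tcont (f : TField) : Prop := Continuous (unc f)

def cst (a : ℝ) : TField := fun _ _ _ => a
def ht : TField := fun _ _ y => y

theorem tsmooth.differentiable {f : TField} (hf : tsmooth f) : Differentiable ℝ (unc f) :=
  ContDiff.differentiable hf (by simp)

theorem tsmooth.cont {f : TField} (hf : tsmooth f) : tcont f := ContDiff.continuous hf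

theorem hd1 {f : TField} (hf : tsmooth f) (t x y : ℝ) :
    HasDerivAt (fun z => f t z y) (fderiv ℝ (unc f) (t, x, y) (0, 1, 0)) x := by
  have h := (hf.differentiable (t, x, y)).hasFDerivAt
  have h2 : HasDerivAt (fun z : ℝ => ((t, z, y) : ℝ × ℝ × ℝ)) (0, 1, 0) x :=
    (hasDerivAt_const x t).prodMk ((hasDerivAt_id x).prodMk (hasDerivAt_const x y))
  exact h.comp_hasDerivAt x h2

theorem hd2 {f : TField} (hf : tsmooth f) (t x y : ℝ) :
    HasDerivAt (fun z => f t x z) (fderiv ℝ (unc f) (t, x, y) (0, 0, 1)) y := by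
  have h := (hf.differentiable (t, x, y)).hasFDerivAt
  have h2 : HasDerivAt (fun z : ℝ => ((t, x, z) : ℝ × ℝ × ℝ)) (0, 0, 1) y :=
    (hasDerivAt_const y t).prodMk ((hasDerivAt_const y x).prodMk (hasDerivAt_id y))
  exact h.comp_hasDerivAt y h2

theorem hdt {f : TField} (hf : tsmooth f) (t x y : ℝ) :
    HasDerivAt (fun z => f z x y) (fderiv ℝ (unc f) (t, x, y) (1, 0, 0)) t := by
  have h := (hf.differentiable (t, x, y)).hasFDerivAt
  have h2 : HasDerivAt (fun z : ℝ => ((z, x, y) : ℝ × ℝ × ℝ)) (1, 0, 0) t :=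
    (hasDerivAt_id t).prodMk ((hasDerivAt_const t x).prodMk (hasDerivAt_const t y))
  exact h.comp_hasDerivAt t h2

theorem unc_d1 {f : TField} (hf : tsmooth f) :
    unc (d1 f) = fun q => fderiv ℝ (unc f) q (0, 1, 0) := by
  funext ⟨t, x, y⟩; exact (hd1 hf t x y).deriv
theorem unc_d2 {f : TField} (hf : tsmooth f) :
    unc (d2 f) = fun q => fderiv ℝ (unc f) q (0, 0, 1) := by
  funext ⟨t, x, y⟩; exact (hd2 hf t x y).deriv
theorem unc_dt {f : TField} (hf : tsmooth f) :
    unc (dt f) = fun q => fderiv ℝ (unc f) q (1, 0, 0) := by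
  funext ⟨t, x, y⟩; exact (hdt hf t x y).deriv

theorem has1 {f : TField} (hf : tsmooth f) (t x y : ℝ) :
    HasDerivAt (fun z => f t z y) (d1 f t x y) x := (hd1 hf t x y).differentiableAt.hasDerivAt
theorem has2 {f : TField} (hf : tsmooth f) (t x y : ℝ) :
    HasDerivAt (fun z => f t x z) (d2 f t x y) y := (hd2 hf t x y).differentiableAt.hasDerivAt
theorem hast {f : TField} (hf : tsmooth f) (t x y : ℝ) :
    HasDerivAt (fun z => f z x y) (dt f t x y) t := (hdt hf t x y).differentiableAt.hasDerivAt

theorem smooth_dir {f : TField} (hf : tsmooth f) (v : ℝ × ℝ × ℝ) :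
    ContDiff ℝ (⊤ : ℕ∞) (fun q => fderiv ℝ (unc f) q v) :=
  (ContDiff.fderiv_right (f := unc f) hf (m := ((⊤ : ℕ∞) : WithTop ℕ∞)) (by norm_cast)).clm_apply
    contDiff_const

@[simp] theorem tsmooth_d1 {f : TField} (hf : tsmooth f) : tsmooth (d1 f) := by
  change ContDiff ℝ _ (unc (d1 f)); rw [unc_d1 hf]; exact smooth_dir hf _
@[simp] theorem tsmooth_d2 {f : TField} (hf : tsmooth f) : tsmooth (d2 f) := by
  change ContDiff ℝ _ (unc (d2 f)); rw [unc_d2 hf]; exact smooth_dir hf _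
@[simp] theorem tsmooth_dt {f : TField} (hf : tsmooth f) : tsmooth (dt f) := by
  change ContDiff ℝ _ (unc (dt f)); rw [unc_dt hf]; exact smooth_dir hf _

theorem dir_comm {f : TField} (hf : tsmooth f) (v w q : ℝ × ℝ × ℝ) :
    fderiv ℝ (fun q => fderiv ℝ (unc f) q v) q w = fderiv ℝ (fun q => fderiv ℝ (unc f) q w) q v := by
  have hd : DifferentiableAt ℝ (fderiv ℝ (unc f)) q :=
    ((ContDiff.fderiv_right (f := unc f) hf (m := 1) (by norm_cast)).differentiable
      (by simp)) q
  have hs : IsSymmSndFDerivAt ℝ (unc f) q :=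
    (ContDiff.contDiffAt (f := unc f) hf).isSymmSndFDerivAt (by simp; exact WithTop.coe_le_coe.2 le_top)
  have key : ∀ a b : ℝ × ℝ × ℝ, fderiv ℝ (fun q => fderiv ℝ (unc f) q a) q b
      = fderiv ℝ (fderiv ℝ (unc f)) q b a := by
    intro a b
    have := (hd.hasFDerivAt.clm_apply (hasFDerivAt_const a q)).fderiv
    rw [this]; simp
  rw [key, key]; exact hs w v

theorem unc_inj {f g : TField} (h : unc f = unc g) : f = g := by
  funext t x y; exact congrFun h (t, x, y)

theorem d2_d1 {f : TField} (hf : tsmooth f) : d2 (d1 f) = d1 (d2 f) := by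
  apply unc_inj
  rw [unc_d2 (tsmooth_d1 hf), unc_d1 (tsmooth_d2 hf), unc_d1 hf, unc_d2 hf]
  funext q; exact dir_comm hf _ _ _
theorem d1_dt {f : TField} (hf : tsmooth f) : d1 (dt f) = dt (d1 f) := by
  apply unc_inj
  rw [unc_d1 (tsmooth_dt hf), unc_dt (tsmooth_d1 hf), unc_d1 hf, unc_dt hf]
  funext q; exact dir_comm hf _ _ _
theorem d2_dt {f : TField} (hf : tsmooth f) : d2 (dt f) = dt (d2 f) := by
  apply unc_inj
  rw [unc_d2 (tsmooth_dt hf), unc_dt (tsmooth_d2 hf), unc_d2 hf, unc_dt hf]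
  funext q; exact dir_comm hf _ _ _

@[simp] theorem tsmooth_add {f g : TField} (hf : tsmooth f) (hg : tsmooth g) : tsmooth (f + g) :=
  ContDiff.add hf hg
@[simp] theorem tsmooth_sub {f g : TField} (hf : tsmooth f) (hg : tsmooth g) : tsmooth (f - g) :=
  ContDiff.sub hf hg
@[simp] theorem tsmooth_mul {f g : TField} (hf : tsmooth f) (hg : tsmooth g) : tsmooth (f * g) :=
  ContDiff.mul hf hg
@[simp] theorem tsmooth_cst (a : ℝ) : tsmooth (cst a) := contDiff_const
@[simp] theorem tsmooth_ht : tsmooth ht := contDiff_snd.comp contDiff_snd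

theorem d1_add {f g : TField} (hf : tsmooth f) (hg : tsmooth g) : d1 (f + g) = d1 f + d1 g := by
  funext t x y; exact ((has1 hf t x y).add (has1 hg t x y)).deriv
theorem d2_add {f g : TField} (hf : tsmooth f) (hg : tsmooth g) : d2 (f + g) = d2 f + d2 g := by
  funext t x y; exact ((has2 hf t x y).add (has2 hg t x y)).deriv
theorem dt_add {f g : TField} (hf : tsmooth f) (hg : tsmooth g) : dt (f + g) = dt f + dt g := by
  funext t x y; exact ((hast hf t x y).add (hast hg t x y)).deriv
theorem d1_sub {f g : TField} (hf : tsmooth f) (hg : tsmooth g) : d1 (f - g) = d1 f - d1 g := by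
  funext t x y; exact ((has1 hf t x y).sub (has1 hg t x y)).deriv
theorem d2_sub {f g : TField} (hf : tsmooth f) (hg : tsmooth g) : d2 (f - g) = d2 f - d2 g := by
  funext t x y; exact ((has2 hf t x y).sub (has2 hg t x y)).deriv
theorem dt_sub {f g : TField} (hf : tsmooth f) (hg : tsmooth g) : dt (f - g) = dt f - dt g := by
  funext t x y; exact ((hast hf t x y).sub (hast hg t x y)).deriv
theorem d1_mul {f g : TField} (hf : tsmooth f) (hg : tsmooth g) :
    d1 (f * g) = d1 f * g + f * d1 g := by
  funext t x y; exact ((has1 hf t x y).mul (has1 hg t x y)).deriv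
theorem d2_mul {f g : TField} (hf : tsmooth f) (hg : tsmooth g) :
    d2 (f * g) = d2 f * g + f * d2 g := by
  funext t x y; exact ((has2 hf t x y).mul (has2 hg t x y)).deriv
theorem dt_mul {f g : TField} (hf : tsmooth f) (hg : tsmooth g) :
    dt (f * g) = dt f * g + f * dt g := by
  funext t x y; exact ((hast hf t x y).mul (hast hg t x y)).deriv
theorem d1_cst (a : ℝ) : d1 (cst a) = cst 0 := by
  funext t x y; simp [d1, cst]
theorem d2_cst (a : ℝ) : d2 (cst a) = cst 0 := by
  funext t x y; simp [d2, cst]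
theorem dt_cst (a : ℝ) : dt (cst a) = cst 0 := by
  funext t x y; simp [dt, cst]
theorem d1_ht : d1 ht = cst 0 := by
  funext t x y; simp [d1, ht, cst]
theorem d2_ht : d2 ht = cst 1 := by
  funext t x y; simp [d2, ht, cst]
theorem dt_ht : dt ht = cst 0 := by
  funext t x y; simp [dt, ht, cst]

/-- composition with a smooth real function -/
def cmp (F : ℝ → ℝ) (f : TField) : TField := fun t x y => F (f t x y)
theorem tsmooth_cmp {F : ℝ → ℝ} (hF : ContDiff ℝ (⊤ : ℕ∞) F) {f : TField} (hf : tsmooth f) :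
    tsmooth (cmp F f) := hF.comp hf
theorem d1_cmp {F : ℝ → ℝ} (hF : ContDiff ℝ (⊤ : ℕ∞) F) {f : TField} (hf : tsmooth f) :
    d1 (cmp F f) = cmp (deriv F) f * d1 f := by
  funext t x y
  exact (((hF.differentiable (by simp)) (f t x y)).hasDerivAt.comp x (has1 hf t x y)).deriv
theorem d2_cmp {F : ℝ → ℝ} (hF : ContDiff ℝ (⊤ : ℕ∞) F) {f : TField} (hf : tsmooth f) :
    d2 (cmp F f) = cmp (deriv F) f * d2 f := by
  funext t x y
  exact (((hF.differentiable (by simp)) (f t x y)).hasDerivAt.comp y (has2 hf t x y)).deriv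
theorem dt_cmp {F : ℝ → ℝ} (hF : ContDiff ℝ (⊤ : ℕ∞) F) {f : TField} (hf : tsmooth f) :
    dt (cmp F f) = cmp (deriv F) f * dt f := by
  funext t x y
  exact (((hF.differentiable (by simp)) (f t x y)).hasDerivAt.comp t (hast hf t x y)).deriv

/-! ### periodicity -/
section per
variable {Γ : ℝ} {f g : TField}
@[simp] theorem per_add (hf : tperiodic Γ f) (hg : tperiodic Γ g) : tperiodic Γ (f + g) :=
  fun t x y => by simp [hf t x y, hg t x y]
@[simp] theorem per_sub (hf : tperiodic Γ f) (hg : tperiodic Γ g) : tperiodic Γ (f - g) :=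
  fun t x y => by simp [hf t x y, hg t x y]
@[simp] theorem per_mul (hf : tperiodic Γ f) (hg : tperiodic Γ g) : tperiodic Γ (f * g) :=
  fun t x y => by simp [hf t x y, hg t x y]
@[simp] theorem per_cst (a : ℝ) : tperiodic Γ (cst a) := fun _ _ _ => rfl
@[simp] theorem per_ht : tperiodic Γ ht := fun _ _ _ => rfl
theorem per_cmp (F : ℝ → ℝ) (hf : tperiodic Γ f) : tperiodic Γ (cmp F f) :=
  fun t x y => by simp [cmp, hf t x y]
@[simp] theorem per_d1 (hf : tperiodic Γ f) : tperiodic Γ (d1 f) := fun t x y => by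
  unfold d1
  rw [← deriv_comp_add_const]; simp only [hf t _ y]
@[simp] theorem per_d2 (hf : tperiodic Γ f) : tperiodic Γ (d2 f) := fun t x y => by
  unfold d2; simp only [hf t x _]
@[simp] theorem per_dt (hf : tperiodic Γ f) : tperiodic Γ (dt f) := fun t x y => by
  unfold dt; simp only [hf _ x y]
end per

/-! ### vanishing on the domain -/
def vanish (F : TField) : Prop := ∀ t x y, 0 ≤ t → y ∈ Icc (0:ℝ) 1 → F t x y = 0

theorem vanish_d1 {F : TField} (h : vanish F) : vanish (d1 F) := by
  intro t x y ht hy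
  have : (fun z => F t z y) = fun _ => 0 := by funext z; exact h t z y ht hy
  simp [d1, this]

theorem deriv_zero_of_on {f : ℝ → ℝ} {s : Set ℝ} {x f' : ℝ} (hf : HasDerivAt f f' x)
    (hs : UniqueDiffWithinAt ℝ s x) (hx : x ∈ s) (h : ∀ z ∈ s, f z = 0) : f' = 0 := by
  have h1 : HasDerivWithinAt f f' s x := hf.hasDerivWithinAt
  have h2 : HasDerivWithinAt f 0 s x :=
    (hasDerivWithinAt_const x s (0:ℝ)).congr (fun z hz => h z hz) (h x hx)
  exact hs.eq_deriv _ h1 h2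

theorem vanish_d2 {F : TField} (hF : tsmooth F) (h : vanish F) : vanish (d2 F) := by
  intro t x y ht hy
  exact deriv_zero_of_on (has2 hF t x y) (uniqueDiffOn_Icc (by norm_num) y hy) hy
    (fun z hz => h t x z ht hz)

theorem dt_zero_of {F : TField} (hF : tsmooth F) {x y : ℝ} (h : ∀ t, 0 ≤ t → F t x y = 0)
    {t : ℝ} (ht : 0 ≤ t) : dt F t x y = 0 :=
  deriv_zero_of_on (hast hF t x y) (uniqueDiffOn_Ici 0 t ht) ht (fun z hz => h z hz)

theorem vanish_dt {F : TField} (hF : tsmooth F) (h : vanish F) : vanish (dt F) := by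
  intro t x y ht hy
  exact dt_zero_of hF (fun s hs => h s x y hs hy) ht
end

section
/-! ### Parametric integrals -/

theorem param_cont {f : ℝ → ℝ → ℝ} (hf : Continuous (fun q : ℝ × ℝ => f q.1 q.2)) (a b : ℝ) :
    Continuous (fun t => ∫ x in a..b, f t x) :=
  intervalIntegral.continuous_parametric_intervalIntegral_of_continuous' hf a b

theorem param_cont3 {f : TField} (hf : tcont f) (a b : ℝ) :
    Continuous (fun q : ℝ × ℝ => ∫ y in a..b, f q.1 q.2 y) := by
  refine intervalIntegral.continuous_parametric_intervalIntegral_of_continuous'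
    (f := fun (q : ℝ × ℝ) y => f q.1 q.2 y) ?_ a b
  have : Continuous (fun r : (ℝ × ℝ) × ℝ => ((r.1.1, r.1.2, r.2) : ℝ × ℝ × ℝ)) := by fun_prop
  exact Continuous.comp hf this

theorem param_deriv {f f' : ℝ → ℝ → ℝ}
    (hf' : Continuous (fun q : ℝ × ℝ => f' q.1 q.2))
    (hfc : ∀ t, Continuous (f t))
    (h : ∀ t x, HasDerivAt (fun s => f s x) (f' t x) t) (a b t : ℝ) :
    HasDerivAt (fun t => ∫ x in a..b, f t x) (∫ x in a..b, f' t x) t := by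
  obtain ⟨C, hC⟩ : ∃ C, ∀ q ∈ Metric.closedBall t 1 ×ˢ uIcc a b, ‖f' q.1 q.2‖ ≤ C := by
    have hK : IsCompact (Metric.closedBall t 1 ×ˢ uIcc a b) :=
      (isCompact_closedBall t 1).prod isCompact_uIcc
    exact hK.exists_bound_of_continuousOn hf'.continuousOn
  refine (intervalIntegral.hasDerivAt_integral_of_dominated_loc_of_deriv_le
    (F := f) (F' := f') (bound := fun _ => C) (s := Metric.closedBall t 1)
    (Metric.closedBall_mem_nhds t one_pos) ?_ ?_ ?_ ?_ ?_ ?_).2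
  · exact Eventually.of_forall fun s => (hfc s).aestronglyMeasurable
  · exact (hfc t).intervalIntegrable _ _
  · exact (hf'.comp (by fun_prop : Continuous fun x : ℝ => (t, x))).aestronglyMeasurable
  · exact Eventually.of_forall fun x hx s hs => hC (s, x) ⟨hs, uIoc_subset_uIcc hx⟩
  · exact intervalIntegrable_const
  · exact Eventually.of_forall fun x _ s _ => h s x

def II (Γ : ℝ) (F : TField) (t : ℝ) : ℝ := ∫ x in (0:ℝ)..Γ, ∫ y in (0:ℝ)..1, F t x y
def BB (Γ c : ℝ) (F : TField) (t : ℝ) : ℝ := ∫ x in (0:ℝ)..Γ, F t x c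

theorem tcont.sec {F : TField} (hF : tcont F) (t : ℝ) :
    Continuous (fun q : ℝ × ℝ => F t q.1 q.2) :=
  Continuous.comp hF (by fun_prop : Continuous fun q : ℝ × ℝ => ((t, q.1, q.2) : ℝ × ℝ × ℝ))
theorem tcont.sec1 {F : TField} (hF : tcont F) (t y : ℝ) : Continuous (fun x => F t x y) :=
  Continuous.comp hF (by fun_prop : Continuous fun x : ℝ => ((t, x, y) : ℝ × ℝ × ℝ))
theorem tcont.sec2 {F : TField} (hF : tcont F) (t x : ℝ) : Continuous (fun y => F t x y) :=
  Continuous.comp (g := unc F) hF (by fun_prop : Continuous fun y : ℝ => ((t, x, y) : ℝ × ℝ × ℝ))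
theorem tcont.sec12 {F : TField} (hF : tcont F) (c : ℝ) :
    Continuous (fun q : ℝ × ℝ => F q.1 q.2 c) :=
  Continuous.comp hF (by fun_prop : Continuous fun q : ℝ × ℝ => ((q.1, q.2, c) : ℝ × ℝ × ℝ))
theorem tcont.inner {F : TField} (hF : tcont F) (t : ℝ) :
    Continuous (fun x => ∫ y in (0:ℝ)..1, F t x y) := param_cont (hF.sec t) 0 1

variable {Γ : ℝ} {F G : TField}

theorem II_cont (hF : tcont F) : Continuous (II Γ F) := param_cont (param_cont3 hF 0 1) 0 Γ
theorem BB_cont (hF : tcont F) (c : ℝ) : Continuous (BB Γ c F) := param_cont (hF.sec12 c) 0 Γ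

theorem II_deriv (hF : tsmooth F) (t : ℝ) : HasDerivAt (II Γ F) (II Γ (dt F) t) t := by
  refine param_deriv (f := fun t x => ∫ y in (0:ℝ)..1, F t x y)
    (f' := fun t x => ∫ y in (0:ℝ)..1, dt F t x y) (param_cont3 (tsmooth_dt hF).cont 0 1)
    (fun t => hF.cont.inner t) (fun t x => ?_) 0 Γ t
  refine param_deriv (f := fun t y => F t x y) (f' := fun t y => dt F t x y) ?_
    (fun t => hF.cont.sec2 t x) (fun t y => hast hF t x y) 0 1 t
  exact Continuous.comp (tsmooth_dt hF).cont
    (by fun_prop : Continuous fun q : ℝ × ℝ => ((q.1, x, q.2) : ℝ × ℝ × ℝ))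

theorem BB_deriv (hF : tsmooth F) (c t : ℝ) : HasDerivAt (BB Γ c F) (BB Γ c (dt F) t) t :=
  param_deriv (f := fun t x => F t x c) (f' := fun t x => dt F t x c)
    ((tsmooth_dt hF).cont.sec12 c) (fun t => hF.cont.sec1 t c) (fun t x => hast hF t x c) 0 Γ t

theorem II_d1 (hF : tsmooth F) (hp : tperiodic Γ F) (t : ℝ) : II Γ (d1 F) t = 0 := by
  have h : ∀ x ∈ uIcc 0 Γ, HasDerivAt (fun x => ∫ y in (0:ℝ)..1, F t x y)
      (∫ y in (0:ℝ)..1, d1 F t x y) x := fun x _ =>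
    param_deriv (f := fun x y => F t x y) (f' := fun x y => d1 F t x y)
      ((tsmooth_d1 hF).cont.sec t) (fun x => hF.cont.sec2 t x) (fun x y => has1 hF t x y) 0 1 x
  unfold II
  rw [intervalIntegral.integral_eq_sub_of_hasDerivAt h
    (((tsmooth_d1 hF).cont.inner t).intervalIntegrable _ _)]
  have : ∀ y, F t Γ y = F t 0 y := fun y => by simpa using hp t 0 y
  simp [this]

theorem BB_d1 (hF : tsmooth F) (hp : tperiodic Γ F) (c t : ℝ) : BB Γ c (d1 F) t = 0 := by
  unfold BB
  rw [intervalIntegral.integral_eq_sub_of_hasDerivAt (fun x _ => has1 hF t x c)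
    (((tsmooth_d1 hF).cont.sec1 t c).intervalIntegrable _ _)]
  have : F t Γ c = F t 0 c := by simpa using hp t 0 c
  simp [this]

theorem II_d2 (hF : tsmooth F) (t : ℝ) : II Γ (d2 F) t = BB Γ 1 F t - BB Γ 0 F t := by
  unfold II BB
  rw [← intervalIntegral.integral_sub ((hF.cont.sec1 t 1).intervalIntegrable _ _)
    ((hF.cont.sec1 t 0).intervalIntegrable _ _)]
  congr 1; funext x
  exact intervalIntegral.integral_eq_sub_of_hasDerivAt (fun y _ => has2 hF t x y)
    (((tsmooth_d2 hF).cont.sec2 t x).intervalIntegrable _ _)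

theorem tcont_add (hF : tcont F) (hG : tcont G) : tcont (F + G) := Continuous.add hF hG
theorem tcont_sub (hF : tcont F) (hG : tcont G) : tcont (F - G) := Continuous.sub hF hG
theorem tcont_mul (hF : tcont F) (hG : tcont G) : tcont (F * G) := Continuous.mul hF hG

theorem II_add (hF : tcont F) (hG : tcont G) (t : ℝ) : II Γ (F + G) t = II Γ F t + II Γ G t := by
  unfold II
  rw [← intervalIntegral.integral_add ((hF.inner t).intervalIntegrable _ _)
    ((hG.inner t).intervalIntegrable _ _)]
  congr 1; funext x
  exact intervalIntegral.integral_add ((hF.sec2 t x).intervalIntegrable _ _)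
    ((hG.sec2 t x).intervalIntegrable _ _)

theorem II_sub (hF : tcont F) (hG : tcont G) (t : ℝ) : II Γ (F - G) t = II Γ F t - II Γ G t := by
  unfold II
  rw [← intervalIntegral.integral_sub ((hF.inner t).intervalIntegrable _ _)
    ((hG.inner t).intervalIntegrable _ _)]
  congr 1; funext x
  exact intervalIntegral.integral_sub ((hF.sec2 t x).intervalIntegrable _ _)
    ((hG.sec2 t x).intervalIntegrable _ _)

theorem BB_add (hF : tcont F) (hG : tcont G) (c t : ℝ) :
    BB Γ c (F + G) t = BB Γ c F t + BB Γ c G t :=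
  intervalIntegral.integral_add ((hF.sec1 t c).intervalIntegrable _ _)
    ((hG.sec1 t c).intervalIntegrable _ _)
theorem BB_sub (hF : tcont F) (hG : tcont G) (c t : ℝ) :
    BB Γ c (F - G) t = BB Γ c F t - BB Γ c G t :=
  intervalIntegral.integral_sub ((hF.sec1 t c).intervalIntegrable _ _)
    ((hG.sec1 t c).intervalIntegrable _ _)

theorem II_smul (a : ℝ) (F : TField) (t : ℝ) : II Γ (cst a * F) t = a * II Γ F t := by
  unfold II
  simp only [Pi.mul_apply, cst, intervalIntegral.integral_const_mul]
theorem BB_smul (a : ℝ) (F : TField) (c t : ℝ) : BB Γ c (cst a * F) t = a * BB Γ c F t := by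
  unfold BB
  simp only [Pi.mul_apply, cst, intervalIntegral.integral_const_mul]
theorem II_cst (a t : ℝ) : II Γ (cst a) t = a * Γ := by
  simp [II, cst, mul_comm]
theorem BB_cst (a c t : ℝ) : BB Γ c (cst a) t = a * Γ := by
  simp [BB, cst, mul_comm]

theorem II_mono (hΓ : 0 ≤ Γ) (hF : tcont F) (hG : tcont G) {t : ℝ}
    (h : ∀ x y, y ∈ Icc (0:ℝ) 1 → F t x y ≤ G t x y) : II Γ F t ≤ II Γ G t := by
  refine intervalIntegral.integral_mono_on hΓ ((hF.inner t).intervalIntegrable _ _)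
    ((hG.inner t).intervalIntegrable _ _) (fun x _ => ?_)
  exact intervalIntegral.integral_mono_on zero_le_one ((hF.sec2 t x).intervalIntegrable _ _)
    ((hG.sec2 t x).intervalIntegrable _ _) (fun y hy => h x y hy)

theorem II_congr {t : ℝ} (h : ∀ x y, y ∈ Icc (0:ℝ) 1 → F t x y = G t x y) :
    II Γ F t = II Γ G t := by
  unfold II
  congr 1; funext x
  refine intervalIntegral.integral_congr (fun y hy => ?_)
  rw [uIcc_of_le zero_le_one] at hy
  exact h x y hy

theorem BB_congr {c t : ℝ} (h : ∀ x, F t x c = G t x c) : BB Γ c F t = BB Γ c G t := by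
  unfold BB; simp only [h]

theorem II_nonneg (hΓ : 0 ≤ Γ) {t : ℝ} (h : ∀ x y, y ∈ Icc (0:ℝ) 1 → 0 ≤ F t x y) :
    0 ≤ II Γ F t :=
  intervalIntegral.integral_nonneg hΓ fun x _ =>
    intervalIntegral.integral_nonneg zero_le_one fun y hy => h x y hy

theorem BB_nonneg (hΓ : 0 ≤ Γ) {c t : ℝ} (h : ∀ x, 0 ≤ F t x c) : 0 ≤ BB Γ c F t :=
  intervalIntegral.integral_nonneg hΓ fun x _ => h x

theorem balance {A X Y Z : TField} {t : ℝ} (hA : tcont A) (hX : tsmooth X) (hY : tsmooth Y)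
    (hZ : tcont Z) (pX : tperiodic Γ X)
    (h : ∀ x y, y ∈ Icc (0:ℝ) 1 → A t x y + d1 X t x y + d2 Y t x y + Z t x y = 0) :
    II Γ A t + (BB Γ 1 Y t - BB Γ 0 Y t) + II Γ Z t = 0 := by
  have h0 : II Γ (A + d1 X + d2 Y + Z) t = II Γ (cst 0) t := II_congr (fun x y hy => h x y hy)
  rw [II_cst, II_add (tcont_add (tcont_add hA (tsmooth_d1 hX).cont) (tsmooth_d2 hY).cont) hZ,
    II_add (tcont_add hA (tsmooth_d1 hX).cont) (tsmooth_d2 hY).cont,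
    II_add hA (tsmooth_d1 hX).cont, II_d1 hX pX, II_d2 hY] at h0
  linarith

/-- A nonnegative continuous field with zero integral vanishes. -/
theorem II_zero (hΓ : 0 < Γ) (hF : tcont F) {t : ℝ} (hp : tperiodic Γ F)
    (h : ∀ x y, y ∈ Icc (0:ℝ) 1 → 0 ≤ F t x y) (h0 : II Γ F t ≤ 0) :
    ∀ x y, y ∈ Icc (0:ℝ) 1 → F t x y = 0 := by
  have hin : ∀ x, 0 ≤ ∫ y in (0:ℝ)..1, F t x y := fun x =>
    intervalIntegral.integral_nonneg zero_le_one fun y hy => h x y hy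
  have key : ∀ x ∈ Icc 0 Γ, ∫ y in (0:ℝ)..1, F t x y = 0 := by
    by_contra hcon
    push Not at hcon
    obtain ⟨x, hx, hne⟩ := hcon
    have := intervalIntegral.integral_pos hΓ (hF.inner t).continuousOn (fun x _ => hin x)
      ⟨x, hx, lt_of_le_of_ne (hin x) (Ne.symm hne)⟩
    exact absurd h0 (not_le.2 this)
  have key2 : ∀ x ∈ Icc 0 Γ, ∀ y ∈ Icc (0:ℝ) 1, F t x y = 0 := by
    intro x hx
    by_contra hcon
    push Not at hcon
    obtain ⟨y, hy, hne⟩ := hcon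
    have := intervalIntegral.integral_pos zero_lt_one (hF.sec2 t x).continuousOn
      (fun y hy => h x y ⟨hy.1.le, hy.2⟩) ⟨y, hy, lt_of_le_of_ne (h x y hy) (Ne.symm hne)⟩
    exact absurd (key x hx) this.ne'
  intro x y hy
  obtain ⟨z, hz, he⟩ := Function.Periodic.exists_mem_Ico₀ (f := fun x => F t x y)
    (fun x => hp t x y) hΓ x
  change F t x y = F t z y at he
  rw [he]; exact key2 z ⟨hz.1, hz.2.le⟩ y hy

/-! ### Ladyzhenskaya type inequality -/

theorem swap_int {f : ℝ → ℝ → ℝ} (hf : Continuous (fun q : ℝ × ℝ => f q.1 q.2)) (a b c d : ℝ) :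
    ∫ x in a..b, ∫ y in c..d, f x y = ∫ y in c..d, ∫ x in a..b, f x y := by
  have hL : ∀ z, HasDerivAt (fun z => ∫ x in a..z, ∫ y in c..d, f x y) (∫ y in c..d, f z y) z :=
    fun z => (param_cont hf c d).integral_hasStrictDerivAt a z |>.hasDerivAt
  have hR : ∀ z, HasDerivAt (fun z => ∫ y in c..d, ∫ x in a..z, f x y) (∫ y in c..d, f z y) z := by
    intro z
    have hs : ∀ y, Continuous fun x => f x y := fun y =>
      hf.comp (by fun_prop : Continuous fun x : ℝ => (x, y))
    refine param_deriv (f := fun z y => ∫ x in a..z, f x y) (f' := f) hf (fun z => ?_)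
      (fun z y => ((hs y).integral_hasStrictDerivAt a z).hasDerivAt) c d z
    exact param_cont (f := fun y x => f x y)
      (hf.comp (by fun_prop : Continuous fun q : ℝ × ℝ => (q.2, q.1))) a z
  have hd : ∀ z, HasDerivAt (fun z => (∫ x in a..z, ∫ y in c..d, f x y)
      - ∫ y in c..d, ∫ x in a..z, f x y) 0 z := fun z => by
    have h := (hL z).sub (hR z)
    rw [sub_self] at h; exact h
  have := is_const_of_deriv_eq_zero (fun z => (hd z).differentiableAt) (fun z => (hd z).deriv) b a
  simp only [intervalIntegral.integral_same, intervalIntegral.integral_zero, sub_self] at this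
  linarith

theorem sup_bound {g g' : ℝ → ℝ} (hg : ∀ x, HasDerivAt g (g' x) x) (hg' : Continuous g')
    {L k : ℝ} (hL : 0 < L) (hk : 0 < k) {x : ℝ} (hx : x ∈ Icc 0 L) :
    g x ^ 2 ≤ ∫ z in (0:ℝ)..L, ((1 / L + k) * g z ^ 2 + (1 / k) * g' z ^ 2) := by
  have hgc : Continuous g := continuous_iff_continuousAt.2 fun x => (hg x).continuousAt
  set M := ∫ z in (0:ℝ)..L, (k * g z ^ 2 + (1 / k) * g' z ^ 2) with hM
  have hb : ∀ z, |2 * g z * g' z| ≤ k * g z ^ 2 + (1 / k) * g' z ^ 2 := by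
    intro z
    have h1 : k * g z ^ 2 + (1 / k) * g' z ^ 2 - 2 * g z * g' z = (1 / k) * (k * g z - g' z) ^ 2 := by
      field_simp; ring
    have h2 : k * g z ^ 2 + (1 / k) * g' z ^ 2 + 2 * g z * g' z = (1 / k) * (k * g z + g' z) ^ 2 := by
      field_simp; ring
    have h3 : 0 ≤ (1 / k) * (k * g z - g' z) ^ 2 := by positivity
    have h4 : 0 ≤ (1 / k) * (k * g z + g' z) ^ 2 := by positivity
    rw [abs_le]; constructor <;> linarith
  have hc1 : Continuous fun z => 2 * g z * g' z := by fun_prop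
  have hc2 : Continuous fun z => k * g z ^ 2 + (1 / k) * g' z ^ 2 := by fun_prop
  have hd : ∀ w ∈ Icc 0 L, g x ^ 2 - M ≤ g w ^ 2 := by
    intro w hw
    have h1 : ∫ z in w..x, 2 * g z * g' z = g x ^ 2 - g w ^ 2 := by
      refine intervalIntegral.integral_eq_sub_of_hasDerivAt (f := fun z => g z ^ 2)
        (fun z _ => ?_) (hc1.intervalIntegrable _ _)
      have := (hg z).pow 2
      simp only [Nat.cast_ofNat, Nat.add_one_sub_one, pow_one] at this
      exact this
    have h2 : |∫ z in w..x, 2 * g z * g' z| ≤ M := by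
      calc |∫ z in w..x, 2 * g z * g' z| ≤ |∫ z in w..x, (k * g z ^ 2 + (1 / k) * g' z ^ 2)| :=
            intervalIntegral.norm_integral_le_abs_of_norm_le (f := fun z => 2 * g z * g' z)
              (Eventually.of_forall fun z => hb z) (hc2.intervalIntegrable w x)
        _ ≤ |∫ z in (0:ℝ)..L, (k * g z ^ 2 + (1 / k) * g' z ^ 2)| := by
            refine intervalIntegral.abs_integral_mono_interval ?_ ?_ (hc2.intervalIntegrable _ _)
            · rw [uIoc_of_le hL.le]
              exact Ioc_subset_Ioc (le_min hw.1 hx.1) (max_le hw.2 hx.2)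
            · exact Eventually.of_forall fun z => by dsimp; positivity
        _ = M := abs_of_nonneg (intervalIntegral.integral_nonneg hL.le fun z _ => by positivity)
    have := abs_le.1 h2
    linarith [this.2]
  have h5 : ∫ z in (0:ℝ)..L, (g x ^ 2 - M) ≤ ∫ z in (0:ℝ)..L, g z ^ 2 :=
    intervalIntegral.integral_mono_on hL.le (continuous_const.intervalIntegrable _ _)
      ((hgc.pow 2).intervalIntegrable _ _) hd
  have h6 : ∫ z in (0:ℝ)..L, ((1 / L + k) * g z ^ 2 + (1 / k) * g' z ^ 2)
      = (1 / L) * (∫ z in (0:ℝ)..L, g z ^ 2) + M := by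
    rw [hM, ← intervalIntegral.integral_const_mul, ← intervalIntegral.integral_add
      ((by fun_prop : Continuous fun z => 1 / L * g z ^ 2).intervalIntegrable _ _)
      (hc2.intervalIntegrable _ _)]
    congr 1; funext z; ring
  rw [h6]
  rw [intervalIntegral.integral_const, sub_zero, smul_eq_mul] at h5
  have h7 : (1 / L) * (L * (g x ^ 2 - M)) ≤ (1 / L) * ∫ z in (0:ℝ)..L, g z ^ 2 :=
    mul_le_mul_of_nonneg_left h5 (by positivity)
  have h8 : (1 / L) * (L * (g x ^ 2 - M)) = g x ^ 2 - M := by field_simp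
  linarith

theorem lad {f g : TField} (hΓ : 0 < Γ) (hf : tsmooth f) (hg : tsmooth g) {k l : ℝ} (hk : 0 < k)
    (hl : 0 < l) (t : ℝ) :
    II Γ (f * f * (g * g)) t ≤ II Γ (cst (1 + k) * (f * f) + cst (1 / k) * (d2 f * d2 f)) t
      * II Γ (cst (1 / Γ + l) * (g * g) + cst (1 / l) * (d1 g * d1 g)) t := by
  set A : TField := cst (1 + k) * (f * f) + cst (1 / k) * (d2 f * d2 f) with hA
  set B : TField := cst (1 / Γ + l) * (g * g) + cst (1 / l) * (d1 g * d1 g) with hB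
  have sA : tsmooth A := by simp (maxDischargeDepth := 20) [hA, hf]
  have sB : tsmooth B := by simp (maxDischargeDepth := 20) [hB, hg]
  have hP : ∀ x, ∀ y ∈ Icc (0:ℝ) 1, f t x y ^ 2 ≤ ∫ y in (0:ℝ)..1, A t x y := by
    intro x y hy
    refine (sup_bound (g := fun y => f t x y) (g' := fun y => d2 f t x y) (fun y => has2 hf t x y)
      ((tsmooth_d2 hf).cont.sec2 t x) one_pos hk hy).trans (le_of_eq ?_)
    congr 1; funext z; simp [hA, cst]; ring
  have hQ : ∀ y, ∀ x ∈ Icc (0:ℝ) Γ, g t x y ^ 2 ≤ ∫ x in (0:ℝ)..Γ, B t x y := by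
    intro y x hx
    refine (sup_bound (g := fun x => g t x y) (g' := fun x => d1 g t x y) (fun x => has1 hg t x y)
      ((tsmooth_d1 hg).cont.sec1 t y) hΓ hl hx).trans (le_of_eq ?_)
    congr 1; funext z; simp [hB, cst]; ring
  have hQc : Continuous fun y => ∫ x in (0:ℝ)..Γ, B t x y :=
    param_cont (f := fun y x => B t x y) ((sB.cont.sec t).comp
      (by fun_prop : Continuous fun q : ℝ × ℝ => (q.2, q.1))) 0 Γ
  have hPc := sA.cont.inner t
  have hC : tcont (f * f * (g * g)) := by
    apply tsmooth.cont; simp (maxDischargeDepth := 20) [hf, hg]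
  calc II Γ (f * f * (g * g)) t
      ≤ ∫ x in (0:ℝ)..Γ, ∫ y in (0:ℝ)..1, (∫ y in (0:ℝ)..1, A t x y) * ∫ x in (0:ℝ)..Γ, B t x y := by
        refine intervalIntegral.integral_mono_on hΓ.le ((hC.inner t).intervalIntegrable _ _)
          (Continuous.intervalIntegrable ?_ _ _) (fun x hx => ?_)
        · simp only [intervalIntegral.integral_const_mul]
          exact hPc.mul continuous_const
        · refine intervalIntegral.integral_mono_on zero_le_one
            ((hC.sec2 t x).intervalIntegrable _ _)
            ((continuous_const.mul hQc).intervalIntegrable _ _) (fun y hy => ?_)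
          have := mul_le_mul (hP x y hy) (hQ y x hx) (sq_nonneg _)
            ((sq_nonneg _).trans (hP x y hy))
          simp only [Pi.mul_apply]
          linarith
    _ = II Γ A t * II Γ B t := by
        simp only [intervalIntegral.integral_const_mul, intervalIntegral.integral_mul_const]
        congr 1
        exact (swap_int (f := fun x y => B t x y) (sB.cont.sec t) 0 Γ 0 1).symm
end

section
set_option linter.unusedSimpArgs false

attribute [simp] Sol.smooth_u1 Sol.smooth_u2 Sol.smooth_T Sol.smooth_p
  Sol.periodic_u1 Sol.periodic_u2 Sol.periodic_T Sol.periodic_p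

variable {Γ Ra Pr : ℝ} {Ls : ℝ≥0∞} (S : Sol Γ Ra Pr Ls)

theorem vort_eq : vort S = d1 S.u2 - d2 S.u1 := rfl
@[simp] theorem smooth_vort : tsmooth (vort S) := by
  rw [vort_eq]; simp (maxDischargeDepth := 20)
@[simp] theorem per_vort : tperiodic Γ (vort S) := by
  rw [vort_eq]; simp (maxDischargeDepth := 20)

theorem incomp_d1 : ∀ t x y, 0 ≤ t → y ∈ Icc (0:ℝ) 1 →
    d1 (d1 S.u1) t x y + d1 (d2 S.u2) t x y = 0 := by
  intro t x y ht hy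
  have h : vanish (d1 S.u1 + d2 S.u2) := fun t x y ht hy => S.incomp t x y ht hy
  have := vanish_d1 h t x y ht hy
  simp (maxDischargeDepth := 20) only [d1_mul, d2_mul, dt_mul, d1_add, d2_add, dt_add, d1_sub, d2_sub, dt_sub, d1_cst, d2_cst, dt_cst, d1_ht, d2_ht, dt_ht, d2_d1, d1_dt, d2_dt,
    tsmooth_mul, tsmooth_add, tsmooth_sub, tsmooth_cst, tsmooth_ht, tsmooth_d1, tsmooth_d2, tsmooth_dt, smooth_vort, Sol.smooth_u1, Sol.smooth_u2, Sol.smooth_T, Sol.smooth_p,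
    Pi.add_apply, Pi.sub_apply, Pi.mul_apply, cst] at this
  exact this
theorem incomp_d2 : ∀ t x y, 0 ≤ t → y ∈ Icc (0:ℝ) 1 →
    d1 (d2 S.u1) t x y + d2 (d2 S.u2) t x y = 0 := by
  intro t x y ht hy
  have h : vanish (d1 S.u1 + d2 S.u2) := fun t x y ht hy => S.incomp t x y ht hy
  have := vanish_d2 (by simp (maxDischargeDepth := 20)) h t x y ht hy
  simp (maxDischargeDepth := 20) only [d1_mul, d2_mul, dt_mul, d1_add, d2_add, dt_add, d1_sub, d2_sub, dt_sub, d1_cst, d2_cst, dt_cst, d1_ht, d2_ht, dt_ht, d2_d1, d1_dt, d2_dt,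
    tsmooth_mul, tsmooth_add, tsmooth_sub, tsmooth_cst, tsmooth_ht, tsmooth_d1, tsmooth_d2, tsmooth_dt, smooth_vort, Sol.smooth_u1, Sol.smooth_u2, Sol.smooth_T, Sol.smooth_p,
    Pi.add_apply, Pi.sub_apply, Pi.mul_apply, cst] at this
  exact this
theorem incomp_dt : ∀ t x y, 0 ≤ t → y ∈ Icc (0:ℝ) 1 →
    dt (d1 S.u1) t x y + dt (d2 S.u2) t x y = 0 := by
  intro t x y ht hy
  have h : vanish (d1 S.u1 + d2 S.u2) := fun t x y ht hy => S.incomp t x y ht hy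
  have := vanish_dt (by simp (maxDischargeDepth := 20)) h t x y ht hy
  simp (maxDischargeDepth := 20) only [d1_mul, d2_mul, dt_mul, d1_add, d2_add, dt_add, d1_sub, d2_sub, dt_sub, d1_cst, d2_cst, dt_cst, d1_ht, d2_ht, dt_ht, d2_d1, d1_dt, d2_dt,
    tsmooth_mul, tsmooth_add, tsmooth_sub, tsmooth_cst, tsmooth_ht, tsmooth_d1, tsmooth_d2, tsmooth_dt, smooth_vort, Sol.smooth_u1, Sol.smooth_u2, Sol.smooth_T, Sol.smooth_p,
    Pi.add_apply, Pi.sub_apply, Pi.mul_apply, cst] at this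
  exact this

theorem vort_val (t x y : ℝ) : vort S t x y = d1 S.u2 t x y - d2 S.u1 t x y := rfl
theorem vort_d1 (t x y : ℝ) : d1 (vort S) t x y = d1 (d1 S.u2) t x y - d1 (d2 S.u1) t x y := by
  rw [vort_eq]
  simp (maxDischargeDepth := 20) only [d1_mul, d2_mul, dt_mul, d1_add, d2_add, dt_add, d1_sub, d2_sub, dt_sub, d1_cst, d2_cst, dt_cst, d1_ht, d2_ht, dt_ht, d2_d1, d1_dt, d2_dt,
    tsmooth_mul, tsmooth_add, tsmooth_sub, tsmooth_cst, tsmooth_ht, tsmooth_d1, tsmooth_d2, tsmooth_dt, smooth_vort, Sol.smooth_u1, Sol.smooth_u2, Sol.smooth_T, Sol.smooth_p,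
    Pi.add_apply, Pi.sub_apply, Pi.mul_apply, cst]
theorem vort_d2 (t x y : ℝ) : d2 (vort S) t x y = d1 (d2 S.u2) t x y - d2 (d2 S.u1) t x y := by
  rw [vort_eq]
  simp (maxDischargeDepth := 20) only [d1_mul, d2_mul, dt_mul, d1_add, d2_add, dt_add, d1_sub, d2_sub, dt_sub, d1_cst, d2_cst, dt_cst, d1_ht, d2_ht, dt_ht, d2_d1, d1_dt, d2_dt,
    tsmooth_mul, tsmooth_add, tsmooth_sub, tsmooth_cst, tsmooth_ht, tsmooth_d1, tsmooth_d2, tsmooth_dt, smooth_vort, Sol.smooth_u1, Sol.smooth_u2, Sol.smooth_T, Sol.smooth_p,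
    Pi.add_apply, Pi.sub_apply, Pi.mul_apply, cst]
theorem vort_dt (t x y : ℝ) : dt (vort S) t x y = dt (d1 S.u2) t x y - dt (d2 S.u1) t x y := by
  rw [vort_eq]
  simp (maxDischargeDepth := 20) only [d1_mul, d2_mul, dt_mul, d1_add, d2_add, dt_add, d1_sub, d2_sub, dt_sub, d1_cst, d2_cst, dt_cst, d1_ht, d2_ht, dt_ht, d2_d1, d1_dt, d2_dt,
    tsmooth_mul, tsmooth_add, tsmooth_sub, tsmooth_cst, tsmooth_ht, tsmooth_d1, tsmooth_d2, tsmooth_dt, smooth_vort, Sol.smooth_u1, Sol.smooth_u2, Sol.smooth_T, Sol.smooth_p,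
    Pi.add_apply, Pi.sub_apply, Pi.mul_apply, cst]

theorem mom1 : vanish (cst Pr⁻¹ * (dt S.u1 + S.u1 * d1 S.u1 + S.u2 * d2 S.u1)
    + d2 (vort S) + d1 S.p) := by
  intro t x y ht hy
  have h1 := S.momentum1 t x y ht hy
  have h2 := incomp_d1 S t x y ht hy
  have h3 := vort_d2 S t x y
  simp (maxDischargeDepth := 20) only [d1_mul, d2_mul, dt_mul, d1_add, d2_add, dt_add, d1_sub, d2_sub, dt_sub, d1_cst, d2_cst, dt_cst, d1_ht, d2_ht, dt_ht, d2_d1, d1_dt, d2_dt,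
    tsmooth_mul, tsmooth_add, tsmooth_sub, tsmooth_cst, tsmooth_ht, tsmooth_d1, tsmooth_d2, tsmooth_dt, smooth_vort, Sol.smooth_u1, Sol.smooth_u2, Sol.smooth_T, Sol.smooth_p,
    Pi.add_apply, Pi.sub_apply, Pi.mul_apply, cst]
  linear_combination h1 + h2 + h3

theorem mom2 : vanish (cst Pr⁻¹ * (dt S.u2 + S.u1 * d1 S.u2 + S.u2 * d2 S.u2)
    - d1 (vort S) + d2 S.p - cst Ra * S.T) := by
  intro t x y ht hy
  have h1 := S.momentum2 t x y ht hy
  have h2 := incomp_d2 S t x y ht hy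
  have h3 := vort_d1 S t x y
  simp (maxDischargeDepth := 20) only [d1_mul, d2_mul, dt_mul, d1_add, d2_add, dt_add, d1_sub, d2_sub, dt_sub, d1_cst, d2_cst, dt_cst, d1_ht, d2_ht, dt_ht, d2_d1, d1_dt, d2_dt,
    tsmooth_mul, tsmooth_add, tsmooth_sub, tsmooth_cst, tsmooth_ht, tsmooth_d1, tsmooth_d2, tsmooth_dt, smooth_vort, Sol.smooth_u1, Sol.smooth_u2, Sol.smooth_T, Sol.smooth_p,
    Pi.add_apply, Pi.sub_apply, Pi.mul_apply, cst]
  linear_combination h1 + h2 - h3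

theorem vort_pde : ∀ t x y, 0 ≤ t → y ∈ Icc (0:ℝ) 1 →
    Pr⁻¹ * (dt (vort S) t x y + S.u1 t x y * d1 (vort S) t x y + S.u2 t x y * d2 (vort S) t x y)
      - d1 (d1 (vort S)) t x y - d2 (d2 (vort S)) t x y - Ra * d1 S.T t x y = 0 := by
  intro t x y ht hy
  have h1 := vanish_d2 (by simp (maxDischargeDepth := 20)) (mom1 S) t x y ht hy
  have h2 := vanish_d1 (mom2 S) t x y ht hy
  have h3 := S.incomp t x y ht hy
  have h4 := vort_val S t x y
  have h5 := vort_d1 S t x y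
  have h6 := vort_d2 S t x y
  have h7 := vort_dt S t x y
  simp (maxDischargeDepth := 20) only [d1_mul, d2_mul, dt_mul, d1_add, d2_add, dt_add, d1_sub, d2_sub, dt_sub, d1_cst, d2_cst, dt_cst, d1_ht, d2_ht, dt_ht, d2_d1, d1_dt, d2_dt,
    tsmooth_mul, tsmooth_add, tsmooth_sub, tsmooth_cst, tsmooth_ht, tsmooth_d1, tsmooth_d2, tsmooth_dt, smooth_vort, Sol.smooth_u1, Sol.smooth_u2, Sol.smooth_T, Sol.smooth_p,
    Pi.add_apply, Pi.sub_apply, Pi.mul_apply, cst] at h1 h2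
  rw [h5, h6, h7]
  linear_combination h2 - h1 - Pr⁻¹ * (d1 S.u2 t x y - d2 S.u1 t x y) * h3

/-! ### Boundary facts -/
theorem bdy_u2 {c t : ℝ} (hc : c = 0 ∨ c = 1) (ht : 0 ≤ t) (x : ℝ) : S.u2 t x c = 0 := by
  rcases hc with rfl | rfl
  · exact S.u2_bot t x ht
  · exact S.u2_top t x ht
theorem bdy_d1u2 {c t : ℝ} (hc : c = 0 ∨ c = 1) (ht : 0 ≤ t) (x : ℝ) : d1 S.u2 t x c = 0 := by
  simp [d1, bdy_u2 S hc ht]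
theorem bdy_dtu2 {c t : ℝ} (hc : c = 0 ∨ c = 1) (ht : 0 ≤ t) (x : ℝ) : dt S.u2 t x c = 0 :=
  dt_zero_of S.smooth_u2 (fun _ hs => bdy_u2 S hc hs x) ht
theorem vort_top {t : ℝ} (ht : 0 ≤ t) (x : ℝ) : vort S t x 1 = (Ls⁻¹).toReal * S.u1 t x 1 := by
  rw [vort_val, bdy_d1u2 S (Or.inr rfl) ht, S.slip_top t x ht]; ring
theorem vort_bot {t : ℝ} (ht : 0 ≤ t) (x : ℝ) : vort S t x 0 = -((Ls⁻¹).toReal * S.u1 t x 0) := by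
  rw [vort_val, bdy_d1u2 S (Or.inl rfl) ht, S.slip_bot t x ht]; ring

/-! ### Integral identities -/

theorem id_heat {F : ℝ → ℝ} (hF : ContDiff ℝ (⊤ : ℕ∞) F) (h0 : deriv F 0 = 0)
    (h1 : deriv F 1 = 0) {t : ℝ} (ht : 0 ≤ t) :
    II Γ (dt (cmp F S.T)) t
      + II Γ (cmp (deriv (deriv F)) S.T * (d1 S.T * d1 S.T + d2 S.T * d2 S.T)) t = 0 := by
  have hF' : ContDiff ℝ (⊤ : ℕ∞) (deriv F) := (contDiff_infty_iff_deriv.1 hF).2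
  have hF'' : ContDiff ℝ (⊤ : ℕ∞) (deriv (deriv F)) := (contDiff_infty_iff_deriv.1 hF').2
  have s0 := tsmooth_cmp hF S.smooth_T
  have s1 := tsmooth_cmp hF' S.smooth_T
  have s2 := tsmooth_cmp hF'' S.smooth_T
  have p0 := per_cmp F S.periodic_T
  have p1 := per_cmp (deriv F) S.periodic_T
  have e1 := d1_cmp hF S.smooth_T
  have e2 := d2_cmp hF S.smooth_T
  have e3 := dt_cmp hF S.smooth_T
  have e4 := d1_cmp hF' S.smooth_T
  have e5 := d2_cmp hF' S.smooth_T
  have hb := balance (Γ := Γ) (t := t) (A := dt (cmp F S.T))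
    (X := S.u1 * cmp F S.T - cmp (deriv F) S.T * d1 S.T)
    (Y := S.u2 * cmp F S.T - cmp (deriv F) S.T * d2 S.T)
    (Z := cmp (deriv (deriv F)) S.T * (d1 S.T * d1 S.T + d2 S.T * d2 S.T))
    (by apply tsmooth.cont; simp (maxDischargeDepth := 20) [s0]) (by simp (maxDischargeDepth := 20) [s0, s1]) (by simp (maxDischargeDepth := 20) [s0, s1])
    (by apply tsmooth.cont; simp (maxDischargeDepth := 20) [s2]) (by simp (maxDischargeDepth := 20) [p0, p1]) (by
      intro x y hy
      simp (maxDischargeDepth := 20) only [d1_mul, d2_mul, dt_mul, d1_add, d2_add, dt_add, d1_sub, d2_sub, dt_sub, d1_cst, d2_cst, dt_cst, d1_ht, d2_ht, dt_ht, d2_d1, d1_dt, d2_dt,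
        tsmooth_mul, tsmooth_add, tsmooth_sub, tsmooth_cst, tsmooth_ht, tsmooth_d1, tsmooth_d2, tsmooth_dt, smooth_vort, Sol.smooth_u1, Sol.smooth_u2, Sol.smooth_T, Sol.smooth_p,
        Pi.add_apply, Pi.sub_apply, Pi.mul_apply, cst, s0, s1, e1, e2, e3, e4, e5]
      have h3 := S.incomp t x y ht hy
      have h4 := S.heat t x y ht hy
      linear_combination cmp (deriv F) S.T t x y * h4 + cmp F S.T t x y * h3)
  have hY : ∀ c, c = 0 ∨ c = 1 →
      BB Γ c (S.u2 * cmp F S.T - cmp (deriv F) S.T * d2 S.T) t = BB Γ c (cst 0) t := by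
    intro c hc
    apply BB_congr; intro x
    have hd : deriv F (S.T t x c) = 0 := by
      rcases hc with rfl | rfl
      · rw [S.T_bot t x ht, h1]
      · rw [S.T_top t x ht, h0]
    simp [cmp, cst, bdy_u2 S hc ht, hd]
  rw [hY 0 (Or.inl rfl), hY 1 (Or.inr rfl), BB_cst, BB_cst] at hb
  linarith

theorem id_nusselt {t : ℝ} (ht : 0 ≤ t) :
    II Γ (dt (cst (1/2) * (S.T * S.T) - (cst 1 - RB.ht) * S.T)) t
      + II Γ (d1 S.T * d1 S.T + d2 S.T * d2 S.T) t = II Γ (S.u2 * S.T - d2 S.T) t := by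
  have hb := balance (Γ := Γ) (t := t) (A := dt (cst (1/2) * (S.T * S.T) - (cst 1 - RB.ht) * S.T))
    (X := S.u1 * (cst (1/2) * (S.T * S.T) - (cst 1 - RB.ht) * S.T)
      - (S.T - (cst 1 - RB.ht)) * d1 S.T)
    (Y := S.u2 * (cst (1/2) * (S.T * S.T) - (cst 1 - RB.ht) * S.T)
      - (S.T - (cst 1 - RB.ht)) * d2 S.T)
    (Z := d1 S.T * d1 S.T + d2 S.T * d2 S.T - (S.u2 * S.T - d2 S.T))
    (by apply tsmooth.cont; simp (maxDischargeDepth := 20)) (by simp (maxDischargeDepth := 20)) (by simp (maxDischargeDepth := 20))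
    (by apply tsmooth.cont; simp (maxDischargeDepth := 20)) (by simp (maxDischargeDepth := 20)) (by
      intro x y hy
      simp (maxDischargeDepth := 20) only [d1_mul, d2_mul, dt_mul, d1_add, d2_add, dt_add, d1_sub, d2_sub, dt_sub, d1_cst, d2_cst, dt_cst, d1_ht, d2_ht, dt_ht, d2_d1, d1_dt, d2_dt,
        tsmooth_mul, tsmooth_add, tsmooth_sub, tsmooth_cst, tsmooth_ht, tsmooth_d1, tsmooth_d2, tsmooth_dt, smooth_vort, Sol.smooth_u1, Sol.smooth_u2, Sol.smooth_T, Sol.smooth_p,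
        Pi.add_apply, Pi.sub_apply, Pi.mul_apply, cst]
      simp only [RB.ht]
      have h3 := S.incomp t x y ht hy
      have h4 := S.heat t x y ht hy
      linear_combination (S.T t x y - (1 - y)) * h4
        + (1/2 * (S.T t x y * S.T t x y) - (1 - y) * S.T t x y) * h3)
  have hY : ∀ c, c = 0 ∨ c = 1 →
      BB Γ c (S.u2 * (cst (1/2) * (S.T * S.T) - (cst 1 - RB.ht) * S.T)
      - (S.T - (cst 1 - RB.ht)) * d2 S.T) t = BB Γ c (cst 0) t := by
    intro c hc
    apply BB_congr; intro x
    have hd : S.T t x c - (1 - c) = 0 := by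
      rcases hc with rfl | rfl
      · rw [S.T_bot t x ht]; ring
      · rw [S.T_top t x ht]; ring
    simp [RB.ht, cst, bdy_u2 S hc ht, hd]
  rw [hY 0 (Or.inl rfl), hY 1 (Or.inr rfl), BB_cst, BB_cst,
    II_sub (by apply tsmooth.cont; simp (maxDischargeDepth := 20)) (by apply tsmooth.cont; simp (maxDischargeDepth := 20))] at hb
  linarith

theorem id_d2T {t : ℝ} (ht : 0 ≤ t) : II Γ (d2 S.T) t = -Γ := by
  rw [II_d2 S.smooth_T]
  have h1 : BB Γ 1 S.T t = BB Γ 1 (cst 0) t := BB_congr fun x => S.T_top t x ht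
  have h0 : BB Γ 0 S.T t = BB Γ 0 (cst 1) t := BB_congr fun x => S.T_bot t x ht
  rw [h1, h0, BB_cst, BB_cst]; ring

theorem id_energy {t : ℝ} (ht : 0 ≤ t) :
    Pr⁻¹ * (1/2) * II Γ (dt (S.u1 * S.u1 + S.u2 * S.u2)) t
      + (Ls⁻¹).toReal * (BB Γ 1 (S.u1 * S.u1) t + BB Γ 0 (S.u1 * S.u1) t)
      + II Γ (vort S * vort S) t = Ra * II Γ (S.u2 * S.T) t := by
  have hb := balance (Γ := Γ) (t := t)
    (A := cst (Pr⁻¹ * (1/2)) * dt (S.u1 * S.u1 + S.u2 * S.u2))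
    (X := cst (Pr⁻¹ * (1/2)) * (S.u1 * (S.u1 * S.u1 + S.u2 * S.u2)) + S.u1 * S.p - S.u2 * vort S)
    (Y := cst (Pr⁻¹ * (1/2)) * (S.u2 * (S.u1 * S.u1 + S.u2 * S.u2)) + S.u2 * S.p + S.u1 * vort S)
    (Z := vort S * vort S - cst Ra * (S.u2 * S.T))
    (by apply tsmooth.cont; simp (maxDischargeDepth := 20)) (by simp (maxDischargeDepth := 20)) (by simp (maxDischargeDepth := 20))
    (by apply tsmooth.cont; simp (maxDischargeDepth := 20)) (by simp (maxDischargeDepth := 20)) (by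
      intro x y hy
      simp (maxDischargeDepth := 20) only [d1_mul, d2_mul, dt_mul, d1_add, d2_add, dt_add, d1_sub, d2_sub, dt_sub, d1_cst, d2_cst, dt_cst, d1_ht, d2_ht, dt_ht, d2_d1, d1_dt, d2_dt,
        tsmooth_mul, tsmooth_add, tsmooth_sub, tsmooth_cst, tsmooth_ht, tsmooth_d1, tsmooth_d2, tsmooth_dt, smooth_vort, Sol.smooth_u1, Sol.smooth_u2, Sol.smooth_T, Sol.smooth_p,
        Pi.add_apply, Pi.sub_apply, Pi.mul_apply, cst]
      have h3 := S.incomp t x y ht hy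
      have h4 := mom1 S t x y ht hy
      have h5 := mom2 S t x y ht hy
      have h6 := vort_val S t x y
      simp (maxDischargeDepth := 20) only [d1_mul, d2_mul, dt_mul, d1_add, d2_add, dt_add, d1_sub, d2_sub, dt_sub, d1_cst, d2_cst, dt_cst, d1_ht, d2_ht, dt_ht, d2_d1, d1_dt, d2_dt,
        tsmooth_mul, tsmooth_add, tsmooth_sub, tsmooth_cst, tsmooth_ht, tsmooth_d1, tsmooth_d2, tsmooth_dt, smooth_vort, Sol.smooth_u1, Sol.smooth_u2, Sol.smooth_T, Sol.smooth_p,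
        Pi.add_apply, Pi.sub_apply, Pi.mul_apply, cst] at h4 h5
      linear_combination S.u1 t x y * h4 + S.u2 t x y * h5 + vort S t x y * h6 +
        (Pr⁻¹ * (1/2) * (S.u1 t x y * S.u1 t x y + S.u2 t x y * S.u2 t x y) + S.p t x y) * h3)
  have h1 : BB Γ 1 (cst (Pr⁻¹ * (1/2)) * (S.u2 * (S.u1 * S.u1 + S.u2 * S.u2)) + S.u2 * S.p
      + S.u1 * vort S) t = BB Γ 1 (cst (Ls⁻¹).toReal * (S.u1 * S.u1)) t := by
    apply BB_congr; intro x
    simp only [Pi.add_apply, Pi.mul_apply, cst, bdy_u2 S (Or.inr rfl) ht, vort_top S ht]; ring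
  have h0 : BB Γ 0 (cst (Pr⁻¹ * (1/2)) * (S.u2 * (S.u1 * S.u1 + S.u2 * S.u2)) + S.u2 * S.p
      + S.u1 * vort S) t = BB Γ 0 (cst (-(Ls⁻¹).toReal) * (S.u1 * S.u1)) t := by
    apply BB_congr; intro x
    simp only [Pi.add_apply, Pi.mul_apply, cst, bdy_u2 S (Or.inl rfl) ht, vort_bot S ht]; ring
  rw [h1, h0, BB_smul, BB_smul, II_smul,
    II_sub (by apply tsmooth.cont; simp (maxDischargeDepth := 20)) (by apply tsmooth.cont; simp (maxDischargeDepth := 20)), II_smul] at hb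
  linarith

theorem id_grad {t : ℝ} (ht : 0 ≤ t) :
    II Γ (d1 S.u1 * d1 S.u1 + d2 S.u1 * d2 S.u1 + d1 S.u2 * d1 S.u2 + d2 S.u2 * d2 S.u2) t
      = II Γ (vort S * vort S) t := by
  have hb := balance (Γ := Γ) (t := t)
    (A := cst 0)
    (X := cst 2 * (S.u1 * d2 S.u2))
    (Y := cst (-2) * (S.u1 * d1 S.u2))
    (Z := d1 S.u1 * d1 S.u1 + d2 S.u1 * d2 S.u1 + d1 S.u2 * d1 S.u2 + d2 S.u2 * d2 S.u2
      - vort S * vort S)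
    (by apply tsmooth.cont; simp (maxDischargeDepth := 20)) (by simp (maxDischargeDepth := 20)) (by simp (maxDischargeDepth := 20))
    (by apply tsmooth.cont; simp (maxDischargeDepth := 20)) (by simp (maxDischargeDepth := 20)) (by
      intro x y hy
      simp (maxDischargeDepth := 20) only [d1_mul, d2_mul, dt_mul, d1_add, d2_add, dt_add, d1_sub, d2_sub, dt_sub, d1_cst, d2_cst, dt_cst, d1_ht, d2_ht, dt_ht, d2_d1, d1_dt, d2_dt,
        tsmooth_mul, tsmooth_add, tsmooth_sub, tsmooth_cst, tsmooth_ht, tsmooth_d1, tsmooth_d2, tsmooth_dt, smooth_vort, Sol.smooth_u1, Sol.smooth_u2, Sol.smooth_T, Sol.smooth_p,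
        Pi.add_apply, Pi.sub_apply, Pi.mul_apply, cst]
      have h3 := S.incomp t x y ht hy
      have h6 := vort_val S t x y
      rw [h6]
      linear_combination (d1 S.u1 t x y + d2 S.u2 t x y) * h3)
  have hY : ∀ c, c = 0 ∨ c = 1 →
      BB Γ c (cst (-2) * (S.u1 * d1 S.u2)) t = BB Γ c (cst 0) t := by
    intro c hc
    apply BB_congr; intro x
    simp [cst, bdy_d1u2 S hc ht]
  rw [hY 0 (Or.inl rfl), hY 1 (Or.inr rfl), BB_cst, BB_cst, II_cst,
    II_sub (by apply tsmooth.cont; simp (maxDischargeDepth := 20)) (by apply tsmooth.cont; simp (maxDischargeDepth := 20))] at hb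
  linarith

/-- the boundary term on the wall `c`. -/
theorem bdy_press {c t : ℝ} (hc : c = 0 ∨ c = 1) (ht : 0 ≤ t) :
    BB Γ c (S.u1 * d2 (vort S)) t
      = BB Γ c (S.p * d1 S.u1) t - Pr⁻¹ * (1/2) * BB Γ c (dt (S.u1 * S.u1)) t := by
  have h : BB Γ c (S.u1 * d2 (vort S)) t = BB Γ c (S.p * d1 S.u1
      - cst (Pr⁻¹ * (1/2)) * dt (S.u1 * S.u1)
      - d1 (S.u1 * S.p + cst (Pr⁻¹ * (1/3)) * (S.u1 * S.u1 * S.u1))) t := by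
    apply BB_congr; intro x
    have hcI : c ∈ Icc (0:ℝ) 1 := by rcases hc with rfl | rfl <;> simp
    have h4 := mom1 S t x c ht hcI
    have h5 := bdy_u2 S hc ht x
    simp (maxDischargeDepth := 20) only [d1_mul, d2_mul, dt_mul, d1_add, d2_add, dt_add, d1_sub, d2_sub, dt_sub, d1_cst, d2_cst, dt_cst, d1_ht, d2_ht, dt_ht, d2_d1, d1_dt, d2_dt,
      tsmooth_mul, tsmooth_add, tsmooth_sub, tsmooth_cst, tsmooth_ht, tsmooth_d1, tsmooth_d2, tsmooth_dt, smooth_vort, Sol.smooth_u1, Sol.smooth_u2, Sol.smooth_T, Sol.smooth_p,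
      Pi.add_apply, Pi.sub_apply, Pi.mul_apply, cst] at h4
    simp (maxDischargeDepth := 20) only [d1_mul, d2_mul, dt_mul, d1_add, d2_add, dt_add, d1_sub, d2_sub, dt_sub, d1_cst, d2_cst, dt_cst, d1_ht, d2_ht, dt_ht, d2_d1, d1_dt, d2_dt,
      tsmooth_mul, tsmooth_add, tsmooth_sub, tsmooth_cst, tsmooth_ht, tsmooth_d1, tsmooth_d2, tsmooth_dt, smooth_vort, Sol.smooth_u1, Sol.smooth_u2, Sol.smooth_T, Sol.smooth_p,
      Pi.add_apply, Pi.sub_apply, Pi.mul_apply, cst]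
    rw [h5] at h4
    linear_combination S.u1 t x c * h4
  rw [h, BB_sub (by apply tsmooth.cont; simp (maxDischargeDepth := 20)) (by apply tsmooth.cont; simp (maxDischargeDepth := 20)),
    BB_sub (by apply tsmooth.cont; simp (maxDischargeDepth := 20)) (by apply tsmooth.cont; simp (maxDischargeDepth := 20)), BB_smul,
    BB_d1 (by simp (maxDischargeDepth := 20)) (by simp (maxDischargeDepth := 20))]
  ring

/-- weighted enstrophy identity with weight `a + b x₂`. -/
theorem id_enst (a b : ℝ) {t : ℝ} (ht : 0 ≤ t) :
    Pr⁻¹ * (1/2) * II Γ (dt ((cst a + cst b * RB.ht) * (vort S * vort S))) t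
      + II Γ ((cst a + cst b * RB.ht) *
          (d1 (vort S) * d1 (vort S) + d2 (vort S) * d2 (vort S) - cst Ra * (vort S * d1 S.T))
        + cst b * (vort S * d2 (vort S) - cst (Pr⁻¹ * (1/2)) * (S.u2 * (vort S * vort S)))) t
      = (Ls⁻¹).toReal * ((a + b) * (BB Γ 1 (S.p * d1 S.u1) t
            - Pr⁻¹ * (1/2) * BB Γ 1 (dt (S.u1 * S.u1)) t)
          + a * (BB Γ 0 (S.p * d1 S.u1) t - Pr⁻¹ * (1/2) * BB Γ 0 (dt (S.u1 * S.u1)) t)) := by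
  have hb := balance (Γ := Γ) (t := t)
    (A := cst (Pr⁻¹ * (1/2)) * dt ((cst a + cst b * RB.ht) * (vort S * vort S)))
    (X := cst (Pr⁻¹ * (1/2)) * (S.u1 * ((cst a + cst b * RB.ht) * (vort S * vort S)))
      - (cst a + cst b * RB.ht) * (vort S * d1 (vort S)))
    (Y := cst (Pr⁻¹ * (1/2)) * (S.u2 * ((cst a + cst b * RB.ht) * (vort S * vort S)))
      - (cst a + cst b * RB.ht) * (vort S * d2 (vort S)))
    (Z := (cst a + cst b * RB.ht) *
          (d1 (vort S) * d1 (vort S) + d2 (vort S) * d2 (vort S) - cst Ra * (vort S * d1 S.T))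
        + cst b * (vort S * d2 (vort S) - cst (Pr⁻¹ * (1/2)) * (S.u2 * (vort S * vort S))))
    (by apply tsmooth.cont; simp (maxDischargeDepth := 20)) (by simp (maxDischargeDepth := 20)) (by simp (maxDischargeDepth := 20))
    (by apply tsmooth.cont; simp (maxDischargeDepth := 20)) (by simp (maxDischargeDepth := 20)) (by
      intro x y hy
      simp (maxDischargeDepth := 20) only [d1_mul, d2_mul, dt_mul, d1_add, d2_add, dt_add, d1_sub, d2_sub, dt_sub, d1_cst, d2_cst, dt_cst, d1_ht, d2_ht, dt_ht, d2_d1, d1_dt, d2_dt,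
        tsmooth_mul, tsmooth_add, tsmooth_sub, tsmooth_cst, tsmooth_ht, tsmooth_d1, tsmooth_d2, tsmooth_dt, smooth_vort, Sol.smooth_u1, Sol.smooth_u2, Sol.smooth_T, Sol.smooth_p,
        Pi.add_apply, Pi.sub_apply, Pi.mul_apply, cst]
      simp only [RB.ht]
      have h3 := S.incomp t x y ht hy
      have h4 := vort_pde S t x y ht hy
      linear_combination (a + b * y) * vort S t x y * h4
        + Pr⁻¹ * (1/2) * (a + b * y) * vort S t x y * vort S t x y * h3)
  have h1 : BB Γ 1 (cst (Pr⁻¹ * (1/2)) * (S.u2 * ((cst a + cst b * RB.ht) * (vort S * vort S)))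
      - (cst a + cst b * RB.ht) * (vort S * d2 (vort S))) t
      = BB Γ 1 (cst (-((Ls⁻¹).toReal * (a + b))) * (S.u1 * d2 (vort S))) t := by
    apply BB_congr; intro x
    simp only [Pi.add_apply, Pi.sub_apply, Pi.mul_apply, cst, RB.ht, bdy_u2 S (Or.inr rfl) ht,
      vort_top S ht]; ring
  have h0 : BB Γ 0 (cst (Pr⁻¹ * (1/2)) * (S.u2 * ((cst a + cst b * RB.ht) * (vort S * vort S)))
      - (cst a + cst b * RB.ht) * (vort S * d2 (vort S))) t
      = BB Γ 0 (cst ((Ls⁻¹).toReal * a) * (S.u1 * d2 (vort S))) t := by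
    apply BB_congr; intro x
    simp only [Pi.add_apply, Pi.sub_apply, Pi.mul_apply, cst, RB.ht, bdy_u2 S (Or.inl rfl) ht,
      vort_bot S ht]; ring
  rw [h1, h0, BB_smul, BB_smul, II_smul, bdy_press S (Or.inl rfl) ht,
    bdy_press S (Or.inr rfl) ht] at hb
  linarith

/-- identity from testing with the time derivative -/
theorem id_dt {t : ℝ} (ht : 0 ≤ t) :
    (1/2) * II Γ (dt (vort S * vort S)) t
      + (Ls⁻¹).toReal * (1/2) * (BB Γ 1 (dt (S.u1 * S.u1)) t + BB Γ 0 (dt (S.u1 * S.u1)) t)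
      + II Γ (cst Pr⁻¹ * (dt S.u1 * dt S.u1 + dt S.u2 * dt S.u2
          + vort S * (S.u1 * dt S.u2 - S.u2 * dt S.u1)) - cst Ra * (S.T * dt S.u2)) t = 0 := by
  have hb := balance (Γ := Γ) (t := t)
    (A := cst (1/2) * dt (vort S * vort S))
    (X := (S.p + cst (Pr⁻¹ * (1/2)) * (S.u1 * S.u1 + S.u2 * S.u2)) * dt S.u1 - vort S * dt S.u2)
    (Y := (S.p + cst (Pr⁻¹ * (1/2)) * (S.u1 * S.u1 + S.u2 * S.u2)) * dt S.u2 + vort S * dt S.u1)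
    (Z := cst Pr⁻¹ * (dt S.u1 * dt S.u1 + dt S.u2 * dt S.u2
          + vort S * (S.u1 * dt S.u2 - S.u2 * dt S.u1)) - cst Ra * (S.T * dt S.u2))
    (by apply tsmooth.cont; simp (maxDischargeDepth := 20)) (by simp (maxDischargeDepth := 20)) (by simp (maxDischargeDepth := 20))
    (by apply tsmooth.cont; simp (maxDischargeDepth := 20)) (by simp (maxDischargeDepth := 20)) (by
      intro x y hy
      simp (maxDischargeDepth := 20) only [d1_mul, d2_mul, dt_mul, d1_add, d2_add, dt_add, d1_sub, d2_sub, dt_sub, d1_cst, d2_cst, dt_cst, d1_ht, d2_ht, dt_ht, d2_d1, d1_dt, d2_dt,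
        tsmooth_mul, tsmooth_add, tsmooth_sub, tsmooth_cst, tsmooth_ht, tsmooth_d1, tsmooth_d2, tsmooth_dt, smooth_vort, Sol.smooth_u1, Sol.smooth_u2, Sol.smooth_T, Sol.smooth_p,
        Pi.add_apply, Pi.sub_apply, Pi.mul_apply, cst]
      have h3 := incomp_dt S t x y ht hy
      have h4 := mom1 S t x y ht hy
      have h5 := mom2 S t x y ht hy
      have h6 := vort_val S t x y
      have h7 := vort_dt S t x y
      simp (maxDischargeDepth := 20) only [d1_mul, d2_mul, dt_mul, d1_add, d2_add, dt_add, d1_sub, d2_sub, dt_sub, d1_cst, d2_cst, dt_cst, d1_ht, d2_ht, dt_ht, d2_d1, d1_dt, d2_dt,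
        tsmooth_mul, tsmooth_add, tsmooth_sub, tsmooth_cst, tsmooth_ht, tsmooth_d1, tsmooth_d2, tsmooth_dt, smooth_vort, Sol.smooth_u1, Sol.smooth_u2, Sol.smooth_T, Sol.smooth_p,
        Pi.add_apply, Pi.sub_apply, Pi.mul_apply, cst] at h4 h5
      rw [h7]
      linear_combination dt S.u1 t x y * h4 + dt S.u2 t x y * h5
        + Pr⁻¹ * (S.u1 t x y * dt S.u2 t x y - S.u2 t x y * dt S.u1 t x y) * h6
        + (Pr⁻¹ * (1/2) * (S.u1 t x y * S.u1 t x y + S.u2 t x y * S.u2 t x y) + S.p t x y) * h3)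
  have h1 : BB Γ 1 ((S.p + cst (Pr⁻¹ * (1/2)) * (S.u1 * S.u1 + S.u2 * S.u2)) * dt S.u2
      + vort S * dt S.u1) t = BB Γ 1 (cst ((Ls⁻¹).toReal * (1/2)) * dt (S.u1 * S.u1)) t := by
    apply BB_congr; intro x
    simp (maxDischargeDepth := 20) only [d1_mul, d2_mul, dt_mul, d1_add, d2_add, dt_add, d1_sub, d2_sub, dt_sub, d1_cst, d2_cst, dt_cst, d1_ht, d2_ht, dt_ht, d2_d1, d1_dt, d2_dt,
      tsmooth_mul, tsmooth_add, tsmooth_sub, tsmooth_cst, tsmooth_ht, tsmooth_d1, tsmooth_d2, tsmooth_dt, smooth_vort, Sol.smooth_u1, Sol.smooth_u2, Sol.smooth_T, Sol.smooth_p,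
      Pi.add_apply, Pi.sub_apply, Pi.mul_apply, cst]
    simp only [bdy_dtu2 S (Or.inr rfl) ht, vort_top S ht]; ring
  have h0 : BB Γ 0 ((S.p + cst (Pr⁻¹ * (1/2)) * (S.u1 * S.u1 + S.u2 * S.u2)) * dt S.u2
      + vort S * dt S.u1) t = BB Γ 0 (cst (-((Ls⁻¹).toReal * (1/2))) * dt (S.u1 * S.u1)) t := by
    apply BB_congr; intro x
    simp (maxDischargeDepth := 20) only [d1_mul, d2_mul, dt_mul, d1_add, d2_add, dt_add, d1_sub, d2_sub, dt_sub, d1_cst, d2_cst, dt_cst, d1_ht, d2_ht, dt_ht, d2_d1, d1_dt, d2_dt,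
      tsmooth_mul, tsmooth_add, tsmooth_sub, tsmooth_cst, tsmooth_ht, tsmooth_d1, tsmooth_d2, tsmooth_dt, smooth_vort, Sol.smooth_u1, Sol.smooth_u2, Sol.smooth_T, Sol.smooth_p,
      Pi.add_apply, Pi.sub_apply, Pi.mul_apply, cst]
    simp only [bdy_dtu2 S (Or.inl rfl) ht, vort_bot S ht]; ring
  rw [h1, h0, BB_smul, BB_smul, II_smul] at hb
  linarith
end

section
/-! ### Real variable part -/

/-- The scalar functions of time entering the argument and the relations between them. -/
structure Dat (Γ Ra Pr l : ℝ) (e D y b1 b0 N th P1 P0 G G1 q R W : ℝ → ℝ) : Prop where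
  ce : Continuous e
  cD : Continuous D
  cb1 : Continuous b1
  cb0 : Continuous b0
  cN : Continuous N
  cth : Continuous th
  cP1 : Continuous P1
  cP0 : Continuous P0
  cR : Continuous R
  cW : Continuous W
  e0 : ∀ t, 0 ≤ t → 0 ≤ e t
  D0 : ∀ t, 0 ≤ t → 0 ≤ D t
  y0 : ∀ t, 0 ≤ t → 0 ≤ y t
  b10 : ∀ t, 0 ≤ t → 0 ≤ b1 t
  b00 : ∀ t, 0 ≤ t → 0 ≤ b0 t
  th0 : ∀ t, 0 ≤ t → 0 ≤ th t
  dy : ∀ t, 0 ≤ t → HasDerivAt y (2 * Pr * (Ra * N t - (e t + l * (b1 t + b0 t)))) t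
  yle : ∀ t, 0 ≤ t → y t ≤ 2 * b0 t + 4 * e t
  Nle : ∀ t, 0 ≤ t → ∀ d, 0 < d → |N t| ≤ (1/2) * (d * y t + Γ / d)
  dq : ∀ t, 0 ≤ t → HasDerivAt q (N t + Γ - th t) t
  qle : ∀ t, 0 ≤ t → |q t| ≤ Γ
  Geq : ∀ t, G t = Pr⁻¹ * (1/2) * (e t + l * (b1 t + b0 t))
  dG : ∀ t, 0 ≤ t → HasDerivAt G (l * (P1 t + P0 t) - D t + Ra * W t) t
  Wle : ∀ t, 0 ≤ t → Ra * W t ≤ (1/2) * (Real.sqrt Ra * e t + Ra * Real.sqrt Ra * th t)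
  Wabs : ∀ t, 0 ≤ t → |W t| ≤ e t + th t
  dG1 : ∀ t, 0 ≤ t → HasDerivAt G1 (l * P1 t + R t) t
  G10 : ∀ t, 0 ≤ t → 0 ≤ G1 t
  G1le : ∀ t, 0 ≤ t → G1 t ≤ G t

theorem ftc {g g' : ℝ → ℝ} {a b : ℝ} (ha : 0 ≤ a) (hab : a ≤ b)
    (h : ∀ t, 0 ≤ t → HasDerivAt g (g' t) t) (hc : Continuous g') :
    ∫ s in a..b, g' s = g b - g a :=
  intervalIntegral.integral_eq_sub_of_hasDerivAt
    (fun t ht => h t (by rw [uIcc_of_le hab] at ht; exact ha.trans ht.1))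
    (hc.intervalIntegrable _ _)

theorem decay_bound {y y' : ℝ → ℝ} {K A : ℝ} (hA : 0 ≤ A) (h0 : 0 ≤ y 0)
    (hy : ∀ t, 0 ≤ t → HasDerivAt y (y' t) t) (hle : ∀ t, 0 ≤ t → y' t ≤ K * (A - y t))
    (t : ℝ) (ht : 0 ≤ t) (hK : 0 ≤ K) : y t ≤ y 0 + A := by
  have hd : ∀ s, 0 ≤ s → HasDerivAt (fun s => (y s - A) * Real.exp (K * s))
      (y' s * Real.exp (K * s) + (y s - A) * (Real.exp (K * s) * K)) s := by
    intro s hs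
    have h1 : HasDerivAt (fun s => Real.exp (K * s)) (Real.exp (K * s) * K) s := by
      simpa using ((hasDerivAt_id s).const_mul K).exp
    exact ((hy s hs).sub_const A).mul h1
  have hanti : AntitoneOn (fun s => (y s - A) * Real.exp (K * s)) (Icc 0 t) := by
    apply antitoneOn_of_deriv_nonpos (convex_Icc 0 t)
    · exact fun s hs => (hd s hs.1).continuousAt.continuousWithinAt
    · intro s hs
      rw [interior_Icc] at hs
      exact (hd s hs.1.le).differentiableAt.differentiableWithinAt
    · intro s hs
      rw [interior_Icc] at hs
      rw [(hd s hs.1.le).deriv]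
      have := hle s hs.1.le
      have he := Real.exp_pos (K * s)
      nlinarith
  have h := hanti (left_mem_Icc.2 ht) (right_mem_Icc.2 ht) ht
  simp only [mul_zero, Real.exp_zero, mul_one] at h
  have he : 1 ≤ Real.exp (K * t) := Real.one_le_exp (by positivity)
  by_contra hcon
  push Not at hcon
  nlinarith

variable {Γ Ra Pr l : ℝ} {e D y b1 b0 N th P1 P0 G G1 q R W : ℝ → ℝ}

theorem Dat.energy (H : Dat Γ Ra Pr l e D y b1 b0 N th P1 P0 G G1 q R W)
    (hΓ : 0 < Γ) (hRa : 0 < Ra) (hPr : 0 < Pr) (hl : 0 < l) :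
    ∃ C, 0 ≤ C ∧ (∀ t, 0 ≤ t → y t ≤ C) ∧ (∀ t, 0 ≤ t → |N t| ≤ C) ∧
      (∀ s t, 0 ≤ s → s ≤ t → ∫ r in s..t, (e r + l * (b1 r + b0 r)) ≤ C * (1 + (t - s))) := by
  set A : ℝ := 2 / l + 4 with hAdef
  have hA : 0 < A := by positivity
  have hyQ : ∀ t, 0 ≤ t → y t ≤ A * (e t + l * (b1 t + b0 t)) := by
    intro t ht
    have h1 := H.yle t ht
    have h2 := H.e0 t ht
    have h3 := H.b10 t ht
    have h4 := H.b00 t ht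
    have : A * (e t + l * (b1 t + b0 t)) = 2 * b0 t + 4 * e t + (2 / l * e t + 2 * b1 t
        + 4 * l * (b1 t + b0 t)) := by
      rw [hAdef]; field_simp; ring
    rw [this]
    have : 0 ≤ (2 / l * e t + 2 * b1 t + 4 * l * (b1 t + b0 t)) := by positivity
    linarith
  have hN : ∀ t, 0 ≤ t → Ra * N t ≤ 1/2 * (e t + l * (b1 t + b0 t)) + 1/2 * (Ra^2 * A * Γ) := by
    intro t ht
    have h1 := (abs_le.1 (H.Nle t ht (1 / (A * Ra)) (by positivity))).2
    have h2 := hyQ t ht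
    have h3 : Ra * N t ≤ Ra * ((1/2) * (1 / (A * Ra) * y t + Γ / (1 / (A * Ra)))) :=
      mul_le_mul_of_nonneg_left h1 hRa.le
    have h4 : Ra * ((1/2) * (1 / (A * Ra) * y t + Γ / (1 / (A * Ra))))
        = 1/2 * (y t / A) + 1/2 * (Ra^2 * A * Γ) := by field_simp
    have h5 : y t / A ≤ e t + l * (b1 t + b0 t) := by rw [div_le_iff₀ hA]; linarith
    linarith
  have hY : ∀ t, 0 ≤ t → y t ≤ y 0 + Ra^2 * A^2 * Γ := by
    intro t ht
    refine decay_bound (K := Pr / A) (by positivity) (H.y0 0 le_rfl) H.dy ?_ t ht (by positivity)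
    intro s hs
    have h1 := hN s hs
    have h2 := hyQ s hs
    have h5 : y s / A ≤ e s + l * (b1 s + b0 s) := by rw [div_le_iff₀ hA]; linarith
    have h6 : Pr / A * (Ra^2 * A^2 * Γ - y s) = Pr * (Ra^2 * A * Γ - y s / A) := by
      field_simp
    rw [h6]
    have : 2 * Pr * (Ra * N s - (e s + l * (b1 s + b0 s)))
        = Pr * (2 * (Ra * N s - (e s + l * (b1 s + b0 s)))) := by ring
    rw [this]
    apply mul_le_mul_of_nonneg_left _ hPr.le
    linarith
  set Y := y 0 + Ra^2 * A^2 * Γ with hYdef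
  have hY0 : 0 ≤ Y := (H.y0 0 le_rfl).trans (hY 0 le_rfl)
  have hB0 : 0 ≤ Ra^2 * A * Γ := by positivity
  have hPY : 0 ≤ Pr⁻¹ * Y := by positivity
  refine ⟨Y + Γ + Ra^2 * A * Γ + Pr⁻¹ * Y, by positivity, ?_, ?_, ?_⟩
  · intro t ht; linarith [hY t ht]
  · intro t ht
    have := H.Nle t ht 1 one_pos
    rw [div_one, one_mul] at this
    linarith [hY t ht]
  · intro s t hs hst
    have hcQ : Continuous fun r => e r + l * (b1 r + b0 r) :=
      H.ce.add ((H.cb1.add H.cb0).const_mul l)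
    have hcy : Continuous fun r => 2 * Pr * (Ra * N r - (e r + l * (b1 r + b0 r))) :=
      ((H.cN.const_mul Ra).sub hcQ).const_mul _
    have h1 := ftc hs hst H.dy hcy
    have h2 : ∫ r in s..t, (e r + l * (b1 r + b0 r)) ≤
        ∫ r in s..t, (Ra^2 * A * Γ - Pr⁻¹ * (2 * Pr * (Ra * N r - (e r + l * (b1 r + b0 r))))) := by
      apply intervalIntegral.integral_mono_on hst (hcQ.intervalIntegrable _ _)
        ((continuous_const.sub (hcy.const_mul _)).intervalIntegrable _ _)
      intro r hr
      have h3 := hN r (hs.trans hr.1)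
      have h4 : Pr⁻¹ * (2 * Pr * (Ra * N r - (e r + l * (b1 r + b0 r))))
        = 2 * (Ra * N r - (e r + l * (b1 r + b0 r))) := by field_simp
      change _ ≤ Ra^2 * A * Γ - Pr⁻¹ * (2 * Pr * (Ra * N r - (e r + l * (b1 r + b0 r))))
      rw [h4]; linarith
    rw [intervalIntegral.integral_sub (continuous_const.intervalIntegrable _ _)
      ((hcy.const_mul _).intervalIntegrable _ _), intervalIntegral.integral_const_mul Pr⁻¹, h1,
      intervalIntegral.integral_const, smul_eq_mul] at h2
    have h5 := hY s hs
    have h6 := H.y0 t (hs.trans hst)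
    have h7 : Pr⁻¹ * (y t - y s) ≥ - (Pr⁻¹ * Y) := by
      have : Pr⁻¹ * (y t - y s) ≥ Pr⁻¹ * (-Y) :=
        mul_le_mul_of_nonneg_left (by linarith) (by positivity)
      linarith
    have h8 : 0 ≤ t - s := by linarith
    have h9 : 0 ≤ (Y + Γ + Pr⁻¹ * Y) * (t - s) := by positivity
    nlinarith

/-- linear growth from a Gronwall inequality on short windows. -/
theorem window_bound {G G' e D : ℝ → ℝ} {C C1 M t0 : ℝ} (hC : 0 ≤ C) (hC1 : 0 ≤ C1) (hM : 0 ≤ M)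
    (hG : ∀ t, 0 ≤ t → HasDerivAt G (G' t) t) (hG' : Continuous G') (cG : Continuous G)
    (ce : Continuous e) (cD : Continuous D)
    (G0 : ∀ t, 0 ≤ t → 0 ≤ G t) (e0 : ∀ t, 0 ≤ t → 0 ≤ e t) (D0 : ∀ t, 0 ≤ t → 0 ≤ D t)
    (hle : ∀ t, 0 ≤ t → ∀ m, 1 ≤ m → G' t ≤ C * (1 + G t) * (1 + e t + m + D t / m))
    (he : ∀ s t, 0 ≤ s → s ≤ t → ∫ r in s..t, e r ≤ C1 * (1 + (t - s)))
    (hGi : ∀ s t, 0 ≤ s → s ≤ t → ∫ r in s..t, G r ≤ C1 * (1 + (t - s)))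
    (hD : ∀ t, t0 ≤ t → ∫ r in (0:ℝ)..t, D r ≤ M * t) :
    ∃ K, 0 ≤ K ∧ ∀ t, t0 ≤ t → 1 ≤ t → G t ≤ K * t := by
  set C2 := C * (2 + 2 * C1 + M) with hC2
  refine ⟨Real.exp C2 * (1 + 2 * C1), by positivity, fun t ht0 ht1 => ?_⟩
  have htp : 0 < t := by linarith
  have hit : 1 / t ≤ 1 := by rw [div_le_one htp]; exact ht1
  have hit0 : 0 < 1 / t := by positivity
  set a := t - 1 / t with ha
  have ha0 : 0 ≤ a := by linarith
  have hat : a ≤ t := by linarith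
  have key : ∀ s ∈ Icc a t, 1 + G t ≤ Real.exp C2 * (1 + G s) := by
    intro s hs
    have hs0 : 0 ≤ s := ha0.trans hs.1
    have hlogd : ∀ r ∈ uIcc s t, HasDerivAt (fun r => Real.log (1 + G r)) (G' r / (1 + G r)) r := by
      intro r hr
      rw [uIcc_of_le hs.2] at hr
      have hr0 := hs0.trans hr.1
      have := (hG r hr0).const_add 1
      exact this.log (by linarith [G0 r hr0])
    have hcont : ContinuousOn (fun r => G' r / (1 + G r)) (uIcc s t) := by
      intro r hr
      rw [uIcc_of_le hs.2] at hr
      have hr0 := hs0.trans hr.1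
      have cG1 : Continuous fun r => 1 + G r := continuous_const.add cG
      have hne : 1 + G r ≠ 0 := by linarith [G0 r hr0]
      exact (hG'.continuousAt.div cG1.continuousAt hne).continuousWithinAt
    have h1 := intervalIntegral.integral_eq_sub_of_hasDerivAt hlogd hcont.intervalIntegrable
    have c2 : Continuous fun r => C * ((1 + t) + e r + (1/t) * D r) := by fun_prop
    have h2 : ∫ r in s..t, G' r / (1 + G r) ≤ ∫ r in s..t, C * ((1 + t) + e r + (1/t) * D r) := by
      apply intervalIntegral.integral_mono_on hs.2 hcont.intervalIntegrable
        (c2.intervalIntegrable _ _)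
      intro r hr
      have hr0 := hs0.trans hr.1
      have hg : 0 < 1 + G r := by linarith [G0 r hr0]
      rw [div_le_iff₀ hg]
      have := hle r hr0 t ht1
      calc G' r ≤ _ := this
        _ = _ := by ring
    have i1 : IntervalIntegrable e volume s t := ce.intervalIntegrable _ _
    have i2 : IntervalIntegrable (fun r => (1/t) * D r) volume s t :=
      (cD.const_mul _).intervalIntegrable _ _
    have i3 : IntervalIntegrable (fun _ : ℝ => 1 + t) volume s t := intervalIntegrable_const
    rw [intervalIntegral.integral_const_mul, intervalIntegral.integral_add (i3.add i1) i2,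
      intervalIntegral.integral_add i3 i1, intervalIntegral.integral_const,
      intervalIntegral.integral_const_mul, smul_eq_mul, h1] at h2
    have h3 : ∫ r in s..t, D r ≤ M * t := by
      refine le_trans ?_ (hD t ht0)
      rw [← intervalIntegral.integral_add_adjacent_intervals
        (cD.intervalIntegrable 0 s) (cD.intervalIntegrable s t)]
      have : 0 ≤ ∫ r in (0:ℝ)..s, D r :=
        intervalIntegral.integral_nonneg hs0 fun r hr => D0 r hr.1
      linarith
    have h4 := he s t hs0 hs.2
    have hts : t - s ≤ 1 / t := by linarith [hs.1]
    have hts0 : 0 ≤ t - s := by linarith [hs.2]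
    have h5 : (t - s) * (1 + t) ≤ 2 := by
      calc (t - s) * (1 + t) ≤ 1 / t * (1 + t) := by
            apply mul_le_mul_of_nonneg_right hts (by linarith)
        _ = 1 / t + 1 := by field_simp
        _ ≤ 2 := by linarith
    have h6 : 1 / t * ∫ r in s..t, D r ≤ M := by
      calc 1 / t * ∫ r in s..t, D r ≤ 1 / t * (M * t) := mul_le_mul_of_nonneg_left h3 hit0.le
        _ = M := by field_simp
    have h7 : C1 * (1 + (t - s)) ≤ 2 * C1 := by nlinarith
    have h8 : Real.log (1 + G t) - Real.log (1 + G s) ≤ C2 := by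
      refine h2.trans ?_
      rw [hC2]
      apply mul_le_mul_of_nonneg_left _ hC
      linarith
    have hgs : 0 < 1 + G s := by linarith [G0 s hs0]
    have hgt : 0 < 1 + G t := by linarith [G0 t htp.le]
    rw [← Real.log_le_log_iff hgt (by positivity), Real.log_mul (Real.exp_pos _).ne' hgs.ne',
      Real.log_exp]
    linarith
  have h1 : ∫ s in a..t, (1 + G t) ≤ ∫ s in a..t, Real.exp C2 * (1 + G s) :=
    intervalIntegral.integral_mono_on hat intervalIntegrable_const
      (((continuous_const.add cG).const_mul _).intervalIntegrable _ _) key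
  rw [intervalIntegral.integral_const, intervalIntegral.integral_const_mul,
    intervalIntegral.integral_add intervalIntegrable_const (cG.intervalIntegrable _ _),
    intervalIntegral.integral_const, smul_eq_mul, smul_eq_mul] at h1
  have hta : t - a = 1 / t := by rw [ha]; ring
  have h2 := hGi a t ha0 hat
  rw [hta] at h1 h2
  have h3 : C1 * (1 + 1 / t) ≤ 2 * C1 := by nlinarith
  have hE := Real.exp_pos C2
  have h4 : 1 / t * (1 + G t) ≤ Real.exp C2 * (1 / t * 1 + 2 * C1) :=
    h1.trans (mul_le_mul_of_nonneg_left (by linarith) hE.le)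
  have h5 : 1 + G t ≤ t * (Real.exp C2 * (1 / t * 1 + 2 * C1)) := by
    calc 1 + G t = t * (1 / t * (1 + G t)) := by field_simp
      _ ≤ _ := mul_le_mul_of_nonneg_left h4 htp.le
  have h6 : t * (Real.exp C2 * (1 / t * 1 + 2 * C1)) = Real.exp C2 * (1 + 2 * C1 * t) := by
    field_simp
  have h7 : Real.exp C2 * (1 + 2 * C1 * t) ≤ Real.exp C2 * ((1 + 2 * C1) * t) :=
    mul_le_mul_of_nonneg_left (by nlinarith) hE.le
  nlinarith

theorem Dat.flux (H : Dat Γ Ra Pr l e D y b1 b0 N th P1 P0 G G1 q R W) {t : ℝ} (ht : 0 ≤ t) :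
    (∫ s in (0:ℝ)..t, th s ≤ (∫ s in (0:ℝ)..t, (N s + Γ)) + 2 * Γ) ∧
    (-(2 * Γ) ≤ ∫ s in (0:ℝ)..t, (N s + Γ)) := by
  have cNG : Continuous fun s => N s + Γ := H.cN.add continuous_const
  have h1 := ftc le_rfl ht H.dq (cNG.sub H.cth)
  rw [intervalIntegral.integral_sub (cNG.intervalIntegrable _ _)
    (H.cth.intervalIntegrable _ _)] at h1
  have h2 := abs_le.1 (H.qle t ht)
  have h3 := abs_le.1 (H.qle 0 le_rfl)
  have h4 : 0 ≤ ∫ s in (0:ℝ)..t, th s :=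
    intervalIntegral.integral_nonneg ht fun r hr => H.th0 r hr.1
  constructor <;> linarith

theorem Dat.ens (H : Dat Γ Ra Pr l e D y b1 b0 N th P1 P0 G G1 q R W)
    (hΓ : 0 < Γ) (hRa : 0 < Ra) (hPr : 0 < Pr) (hl : 0 < l) {t : ℝ} (ht : 0 ≤ t) :
    ∫ s in (0:ℝ)..t, e s ≤ Ra * (∫ s in (0:ℝ)..t, (N s + Γ)) + Pr⁻¹ * (1/2) * y 0 := by
  have hcQ : Continuous fun r => e r + l * (b1 r + b0 r) :=
    H.ce.add ((H.cb1.add H.cb0).const_mul l)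
  have hcy : Continuous fun r => 2 * Pr * (Ra * N r - (e r + l * (b1 r + b0 r))) :=
    ((H.cN.const_mul Ra).sub hcQ).const_mul _
  have h1 := ftc le_rfl ht H.dy hcy
  have h2 : ∫ r in (0:ℝ)..t, e r ≤
      ∫ r in (0:ℝ)..t, (Ra * (N r + Γ)
        - Pr⁻¹ * (1/2) * (2 * Pr * (Ra * N r - (e r + l * (b1 r + b0 r))))) := by
    apply intervalIntegral.integral_mono_on ht (H.ce.intervalIntegrable _ _)
      ((((H.cN.add continuous_const).const_mul _).sub (hcy.const_mul _)).intervalIntegrable _ _)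
    intro r hr
    change _ ≤ Ra * (N r + Γ) - Pr⁻¹ * (1/2) * (2 * Pr * (Ra * N r - (e r + l * (b1 r + b0 r))))
    have h4 : Pr⁻¹ * (1/2) * (2 * Pr * (Ra * N r - (e r + l * (b1 r + b0 r))))
      = (Ra * N r - (e r + l * (b1 r + b0 r))) := by field_simp
    have h5 := H.b10 r hr.1
    have h6 := H.b00 r hr.1
    rw [h4]
    have : 0 ≤ l * (b1 r + b0 r) + Ra * Γ := by positivity
    linarith
  have cNG : Continuous fun s => N s + Γ := H.cN.add continuous_const
  rw [intervalIntegral.integral_sub ((cNG.const_mul _).intervalIntegrable _ _)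
    ((hcy.const_mul _).intervalIntegrable _ _), intervalIntegral.integral_const_mul (Pr⁻¹ * (1/2)), h1,
    intervalIntegral.integral_const_mul Ra] at h2
  have h6 : 0 ≤ Pr⁻¹ * (1/2) * y t := by have := H.y0 t ht; positivity
  linarith

theorem Dat.main (H : Dat Γ Ra Pr l e D y b1 b0 N th P1 P0 G G1 q R W)
    (hΓ : 0 < Γ) (hRa : 0 < Ra) (hPr : 0 < Pr) (hl : 0 < l) :
    ∃ C, ∀ t, 0 ≤ t → ∫ s in (0:ℝ)..t, D s ≤ l * ((∫ s in (0:ℝ)..t, P1 s) + ∫ s in (0:ℝ)..t, P0 s)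
      + Ra * Real.sqrt Ra * (∫ s in (0:ℝ)..t, (N s + Γ)) + C := by
  refine ⟨G 0 + (1/2) * (Real.sqrt Ra * (Pr⁻¹ * (1/2) * y 0)) + Ra * Real.sqrt Ra * Γ,
    fun t ht => ?_⟩
  have cP : Continuous fun t => l * (P1 t + P0 t) := (H.cP1.add H.cP0).const_mul l
  have cRW : Continuous fun t => Ra * W t := H.cW.const_mul Ra
  have cPD : Continuous fun t => l * (P1 t + P0 t) - D t := cP.sub H.cD
  have h1 := ftc le_rfl ht H.dG ((cP.sub H.cD).add cRW)
  rw [intervalIntegral.integral_add (cPD.intervalIntegrable _ _)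
    (cRW.intervalIntegrable _ _), intervalIntegral.integral_sub (cP.intervalIntegrable _ _)
    (H.cD.intervalIntegrable _ _), intervalIntegral.integral_const_mul l,
    intervalIntegral.integral_add (H.cP1.intervalIntegrable _ _)
    (H.cP0.intervalIntegrable _ _)] at h1
  have h2 : ∫ s in (0:ℝ)..t, Ra * W s ≤
      ∫ s in (0:ℝ)..t, (1/2) * (Real.sqrt Ra * e s + Ra * Real.sqrt Ra * th s) := by
    apply intervalIntegral.integral_mono_on ht (cRW.intervalIntegrable _ _)
      ((((H.ce.const_mul _).add (H.cth.const_mul _)).const_mul _).intervalIntegrable _ _)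
    exact fun r hr => H.Wle r hr.1
  rw [intervalIntegral.integral_const_mul (1/2 : ℝ),
    intervalIntegral.integral_add ((H.ce.const_mul _).intervalIntegrable _ _)
    ((H.cth.const_mul _).intervalIntegrable _ _), intervalIntegral.integral_const_mul (Real.sqrt Ra),
    intervalIntegral.integral_const_mul (Ra * Real.sqrt Ra)] at h2
  have h3 := mul_le_mul_of_nonneg_left (H.ens hΓ hRa hPr hl ht) (Real.sqrt_nonneg Ra)
  have h4 := mul_le_mul_of_nonneg_left (H.flux ht).1
    (mul_nonneg hRa.le (Real.sqrt_nonneg Ra))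
  have h5 : 0 ≤ G t := (H.G10 t ht).trans (H.G1le t ht)
  linarith

theorem Dat.press (H : Dat Γ Ra Pr l e D y b1 b0 N th P1 P0 G G1 q R W)
    (hΓ : 0 < Γ) (hRa : 0 < Ra) (hPr : 0 < Pr) (hl : 0 < l) {CR CG : ℝ} (hCR : 0 ≤ CR)
    (hCG : 0 ≤ CG)
    (hR : ∀ t, 0 ≤ t → |R t| ≤ CR * (1 + D t + e t + th t))
    (hG : ∀ t, 0 ≤ t → ∀ m, 1 ≤ m → l * (P1 t + P0 t) - D t + Ra * W t
      ≤ CG * (1 + G t) * (1 + e t + m + D t / m)) {M t0 : ℝ} (hM : 0 ≤ M)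
    (hD : ∀ t, t0 ≤ t → ∫ r in (0:ℝ)..t, D r ≤ M * t) :
    ∃ K, ∀ t, t0 ≤ t → 1 ≤ t →
      |∫ s in (0:ℝ)..t, P1 s| ≤ K * t ∧ |∫ s in (0:ℝ)..t, P0 s| ≤ K * t := by
  obtain ⟨C, hC, -, hN, hQ⟩ := H.energy hΓ hRa hPr hl
  have cP : Continuous fun t => l * (P1 t + P0 t) := (H.cP1.add H.cP0).const_mul l
  have cRW : Continuous fun t => Ra * W t := H.cW.const_mul Ra
  have cPD : Continuous fun t => l * (P1 t + P0 t) - D t := cP.sub H.cD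
  have cG' : Continuous fun t => l * (P1 t + P0 t) - D t + Ra * W t := (cP.sub H.cD).add cRW
  have hcQ : Continuous fun r => e r + l * (b1 r + b0 r) :=
    H.ce.add ((H.cb1.add H.cb0).const_mul l)
  have Gfun : G = fun t => Pr⁻¹ * (1/2) * (e t + l * (b1 t + b0 t)) := funext H.Geq
  have cG : Continuous G := by rw [Gfun]; exact hcQ.const_mul _
  have G0 : ∀ t, 0 ≤ t → 0 ≤ G t := fun t ht => (H.G10 t ht).trans (H.G1le t ht)
  have he : ∀ s t, 0 ≤ s → s ≤ t → ∫ r in s..t, e r ≤ C * (1 + (t - s)) := by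
    intro s t hs hst
    refine le_trans ?_ (hQ s t hs hst)
    apply intervalIntegral.integral_mono_on hst (H.ce.intervalIntegrable _ _)
      (hcQ.intervalIntegrable _ _)
    intro r hr
    have h5 := H.b10 r (hs.trans hr.1)
    have h6 := H.b00 r (hs.trans hr.1)
    have : 0 ≤ l * (b1 r + b0 r) := by positivity
    linarith
  have hGi : ∀ s t, 0 ≤ s → s ≤ t → ∫ r in s..t, G r ≤ Pr⁻¹ * (1/2) * C * (1 + (t - s)) := by
    intro s t hs hst
    rw [Gfun, intervalIntegral.integral_const_mul, mul_assoc _ C]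
    exact mul_le_mul_of_nonneg_left (hQ s t hs hst) (by positivity)
  have hx : 0 ≤ Pr⁻¹ * (1/2) * C := by positivity
  obtain ⟨K, hK, hKb⟩ := window_bound (C1 := C + Pr⁻¹ * (1/2) * C) hCG (by positivity) hM H.dG cG' cG
    H.ce H.cD G0 H.e0 H.D0 hG
    (fun s t hs hst => (he s t hs hst).trans
      (mul_le_mul_of_nonneg_right (by linarith) (by linarith)))
    (fun s t hs hst => (hGi s t hs hst).trans
      (mul_le_mul_of_nonneg_right (by linarith) (by linarith))) hD
  -- integrals of the remainders
  set B := 1 + M + 2 * C + (C + 3 * Γ) with hB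
  have hB0 : 0 ≤ B := by positivity
  have hrem : ∀ t, t0 ≤ t → 1 ≤ t → ∫ s in (0:ℝ)..t, (1 + D s + e s + th s) ≤ B * t := by
    intro t ht0 ht1
    have ht : 0 ≤ t := by linarith
    have i0 : IntervalIntegrable (fun _ : ℝ => (1:ℝ)) volume 0 t := intervalIntegrable_const
    have i1 := H.cD.intervalIntegrable (μ := volume) 0 t
    have i2 := H.ce.intervalIntegrable (μ := volume) 0 t
    have i3 := H.cth.intervalIntegrable (μ := volume) 0 t
    rw [intervalIntegral.integral_add ((i0.add i1).add i2) i3,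
      intervalIntegral.integral_add (i0.add i1) i2,
      intervalIntegral.integral_add i0 i1, intervalIntegral.integral_const, smul_eq_mul]
    have h1 := hD t ht0
    have h2 := he 0 t le_rfl ht
    have h3 := (H.flux ht).1
    have h4 : ∫ s in (0:ℝ)..t, (N s + Γ) ≤ ∫ s in (0:ℝ)..t, (C + Γ) := by
      apply intervalIntegral.integral_mono_on ht
        ((H.cN.add continuous_const).intervalIntegrable _ _) intervalIntegrable_const
      intro r hr
      change N r + Γ ≤ _
      linarith [(abs_le.1 (hN r hr.1)).2]
    rw [intervalIntegral.integral_const, smul_eq_mul] at h4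
    have h5 : C * 1 ≤ C * t := mul_le_mul_of_nonneg_left ht1 hC
    have h6 : Γ * 1 ≤ Γ * t := mul_le_mul_of_nonneg_left ht1 hΓ.le
    rw [hB]
    linarith
  have habs : ∀ (f : ℝ → ℝ) (k : ℝ), 0 ≤ k → Continuous f →
      (∀ t, 0 ≤ t → |f t| ≤ k * (1 + D t + e t + th t)) →
      ∀ t, t0 ≤ t → 1 ≤ t → |∫ s in (0:ℝ)..t, f s| ≤ k * B * t := by
    intro f k hk cf hf t ht0 ht1
    have ht : 0 ≤ t := by linarith
    have cc : Continuous fun t => 1 + D t + e t + th t :=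
      ((continuous_const.add H.cD).add H.ce).add H.cth
    refine (intervalIntegral.abs_integral_le_integral_abs ht).trans ?_
    have h1 : ∫ s in (0:ℝ)..t, |f s| ≤ ∫ s in (0:ℝ)..t, k * (1 + D s + e s + th s) :=
      intervalIntegral.integral_mono_on ht (cf.abs.intervalIntegrable _ _)
        ((cc.const_mul k).intervalIntegrable _ _) fun r hr => hf r hr.1
    rw [intervalIntegral.integral_const_mul] at h1
    have := mul_le_mul_of_nonneg_left (hrem t ht0 ht1) hk
    linarith
  have hS : ∀ t, 0 ≤ t → 0 ≤ 1 + D t + e t + th t ∧ |D t| ≤ 1 + D t + e t + th t ∧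
      |W t| ≤ 1 + D t + e t + th t := by
    intro t ht
    have h1 := H.D0 t ht
    have h2 := H.e0 t ht
    have h3 := H.th0 t ht
    have h4 := H.Wabs t ht
    refine ⟨by positivity, ?_, by linarith⟩
    rw [abs_of_nonneg h1]; linarith
  refine ⟨l⁻¹ * (2 * K + G 0 + (CR + 1 + Ra + CR) * B), fun t ht0 ht1 => ?_⟩
  have ht : 0 ≤ t := by linarith
  have hG0 := G0 0 le_rfl
  have hG0t : G 0 * 1 ≤ G 0 * t := mul_le_mul_of_nonneg_left ht1 hG0
  have hGt := hKb t ht0 ht1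
  have a1 := abs_le.1 (habs R CR hCR H.cR hR t ht0 ht1)
  have a2 := abs_le.1 (habs D 1 zero_le_one H.cD (fun t ht => by linarith [hS t ht]) t ht0 ht1)
  have a3 := abs_le.1 (habs W 1 zero_le_one H.cW (fun t ht => by linarith [hS t ht]) t ht0 ht1)
  have a3l := mul_le_mul_of_nonneg_left a3.1 hRa.le
  have a3u := mul_le_mul_of_nonneg_left a3.2 hRa.le
  have f1 := ftc le_rfl ht H.dG1 ((H.cP1.const_mul l).add H.cR)
  have f2 := ftc le_rfl ht H.dG cG'
  rw [intervalIntegral.integral_add ((H.cP1.const_mul l).intervalIntegrable _ _)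
    (H.cR.intervalIntegrable _ _), intervalIntegral.integral_const_mul l] at f1
  rw [intervalIntegral.integral_add (cPD.intervalIntegrable _ _)
    (cRW.intervalIntegrable _ _), intervalIntegral.integral_sub (cP.intervalIntegrable _ _)
    (H.cD.intervalIntegrable _ _), intervalIntegral.integral_const_mul l,
    intervalIntegral.integral_const_mul Ra,
    intervalIntegral.integral_add (H.cP1.intervalIntegrable _ _)
    (H.cP0.intervalIntegrable _ _)] at f2
  have g1 := H.G10 t ht
  have g2 := H.G1le t ht
  have g3 := H.G10 0 le_rfl
  have g4 := H.G1le 0 le_rfl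
  have hKt : 0 ≤ K * t := by positivity
  have hBt : 0 ≤ B * t := by positivity
  have hRB : 0 ≤ Ra * (B * t) := by positivity
  have hCB : 0 ≤ CR * (B * t) := by positivity
  have scale : ∀ x : ℝ, |l * x| ≤ (2 * K + G 0 + (CR + 1 + Ra + CR) * B) * t →
      |x| ≤ l⁻¹ * (2 * K + G 0 + (CR + 1 + Ra + CR) * B) * t := by
    intro x hx
    rw [abs_mul, abs_of_pos hl] at hx
    rw [mul_assoc, ← div_eq_inv_mul, le_div_iff₀ hl]
    linarith
  have ex : (2 * K + G 0 + (CR + 1 + Ra + CR) * B) * t = 2 * (K * t) + G 0 * t + 2 * (CR * (B * t))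
    + B * t + Ra * (B * t) := by ring
  have r1 : CR * B * t = CR * (B * t) := by ring
  have r2 : 1 * B * t = B * t := by ring
  rw [r1] at a1
  rw [r2] at a2
  have r3 : Ra * (1 * B * t) = Ra * (B * t) := by ring
  have r4 : Ra * -(1 * B * t) = -(Ra * (B * t)) := by ring
  rw [r3] at a3u
  rw [r4] at a3l
  constructor
  · apply scale; rw [ex, abs_le]; constructor <;> linarith
  · apply scale; rw [ex, abs_le]; constructor <;> linarith
end

section
set_option linter.unusedSimpArgs false

/-! ### A smooth convex function vanishing exactly on `[0,1]` -/
def cvw (r : ℝ) : ℝ := expNegInvGlue (r - 1) + expNegInvGlue (-r)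
def cv1 (s : ℝ) : ℝ := ∫ r in (0:ℝ)..s, cvw r
def cv (s : ℝ) : ℝ := ∫ r in (0:ℝ)..s, cv1 r

theorem cvw_smooth : ContDiff ℝ (⊤ : ℕ∞) cvw := by
  unfold cvw
  exact (expNegInvGlue.contDiff.comp (contDiff_id.sub contDiff_const)).add
    (expNegInvGlue.contDiff.comp contDiff_neg)
theorem cvw_nonneg (r : ℝ) : 0 ≤ cvw r :=
  add_nonneg (expNegInvGlue.nonneg _) (expNegInvGlue.nonneg _)
theorem cvw_zero {r : ℝ} (h : r ∈ Icc (0:ℝ) 1) : cvw r = 0 := by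
  unfold cvw
  rw [expNegInvGlue.zero_of_nonpos (by linarith [h.2]),
    expNegInvGlue.zero_of_nonpos (by linarith [h.1]), add_zero]
theorem cvw_pos {r : ℝ} (h : r < 0 ∨ 1 < r) : 0 < cvw r := by
  unfold cvw
  rcases h with h | h
  · exact add_pos_of_nonneg_of_pos (expNegInvGlue.nonneg _)
      (expNegInvGlue.pos_of_pos (by linarith))
  · exact add_pos_of_pos_of_nonneg (expNegInvGlue.pos_of_pos (by linarith))
      (expNegInvGlue.nonneg _)
theorem prim_smooth {f : ℝ → ℝ} (hf : ContDiff ℝ (⊤ : ℕ∞) f) :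
    ContDiff ℝ (⊤ : ℕ∞) (fun s => ∫ r in (0:ℝ)..s, f r) ∧
      deriv (fun s => ∫ r in (0:ℝ)..s, f r) = f := by
  have hd : ∀ s, HasDerivAt (fun s => ∫ r in (0:ℝ)..s, f r) (f s) s := fun s =>
    intervalIntegral.integral_hasDerivAt_right (hf.continuous.intervalIntegrable _ _)
      (hf.continuous.stronglyMeasurableAtFilter _ _) hf.continuous.continuousAt
  have he : deriv (fun s => ∫ r in (0:ℝ)..s, f r) = f := funext fun s => (hd s).deriv
  refine ⟨contDiff_infty_iff_deriv.2 ⟨fun s => (hd s).differentiableAt, ?_⟩, he⟩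
  rw [he]; exact hf
theorem cv1_smooth : ContDiff ℝ (⊤ : ℕ∞) cv1 := (prim_smooth cvw_smooth).1
theorem cv_smooth : ContDiff ℝ (⊤ : ℕ∞) cv := (prim_smooth cv1_smooth).1
theorem cv1_deriv : deriv cv1 = cvw := (prim_smooth cvw_smooth).2
theorem cv_deriv : deriv cv = cv1 := (prim_smooth cv1_smooth).2
theorem prim_zero {f : ℝ → ℝ} (hf : ∀ r ∈ Icc (0:ℝ) 1, f r = 0) {s : ℝ} (hs : s ∈ Icc (0:ℝ) 1) :
    ∫ r in (0:ℝ)..s, f r = 0 := by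
  rw [intervalIntegral.integral_congr (g := fun _ => (0:ℝ))]
  · simp
  · intro r hr
    rw [uIcc_of_le hs.1] at hr
    exact hf r ⟨hr.1, hr.2.trans hs.2⟩
theorem cv1_zero {s : ℝ} (hs : s ∈ Icc (0:ℝ) 1) : cv1 s = 0 :=
  prim_zero (fun _ h => cvw_zero h) hs
theorem cv_zero {s : ℝ} (hs : s ∈ Icc (0:ℝ) 1) : cv s = 0 :=
  prim_zero (fun _ h => cv1_zero h) hs
theorem cv1_pos {s : ℝ} (hs : 1 < s) : 0 < cv1 s := by
  have h := cvw_smooth.continuous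
  unfold cv1
  rw [← intervalIntegral.integral_add_adjacent_intervals (h.intervalIntegrable 0 1)
    (h.intervalIntegrable 1 s), prim_zero (fun _ h => cvw_zero h) (by simp), zero_add]
  exact intervalIntegral.intervalIntegral_pos_of_pos_on (h.intervalIntegrable 1 s)
    (fun r hr => cvw_pos (Or.inr hr.1)) hs
theorem cv1_neg {s : ℝ} (hs : s < 0) : cv1 s < 0 := by
  have h := cvw_smooth.continuous
  unfold cv1
  rw [intervalIntegral.integral_symm]
  have := intervalIntegral.intervalIntegral_pos_of_pos_on (h.intervalIntegrable s 0)
    (fun r hr => cvw_pos (Or.inl hr.2)) hs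
  linarith
theorem cv_pos {s : ℝ} (hs : s < 0 ∨ 1 < s) : 0 < cv s := by
  have h := cv1_smooth.continuous
  unfold cv
  rcases hs with hs | hs
  · rw [intervalIntegral.integral_symm, ← intervalIntegral.integral_neg]
    exact intervalIntegral.intervalIntegral_pos_of_pos_on (h.neg.intervalIntegrable s 0)
      (fun r hr => by have := cv1_neg hr.2; linarith) hs
  · rw [← intervalIntegral.integral_add_adjacent_intervals (h.intervalIntegrable 0 1)
      (h.intervalIntegrable 1 s), prim_zero (fun _ h => cv1_zero h) (by simp), zero_add]
    exact intervalIntegral.intervalIntegral_pos_of_pos_on (h.intervalIntegrable 1 s)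
      (fun r hr => cv1_pos hr.1) hs
theorem cv_nonneg (s : ℝ) : 0 ≤ cv s := by
  by_cases h : s ∈ Icc (0:ℝ) 1
  · rw [cv_zero h]
  · apply (cv_pos _).le
    by_contra hc
    push Not at hc
    exact h ⟨hc.1, hc.2⟩

variable {Γ Ra Pr : ℝ} {Ls : ℝ≥0∞} (S : Sol Γ Ra Pr Ls)

theorem II_add' {F G : TField} (hF : tsmooth F) (hG : tsmooth G) (t : ℝ) :
    II Γ (F + G) t = II Γ F t + II Γ G t := II_add hF.cont hG.cont t
theorem II_sub' {F G : TField} (hF : tsmooth F) (hG : tsmooth G) (t : ℝ) :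
    II Γ (F - G) t = II Γ F t - II Γ G t := II_sub hF.cont hG.cont t

/-- maximum principle for the temperature -/
theorem T_range (hΓ : 0 < Γ) (hT0 : T0cond S) : ∀ t x y, 0 ≤ t → y ∈ Icc (0:ℝ) 1 →
    S.T t x y ∈ Icc (0:ℝ) 1 := by
  intro t x y ht hy
  have s0 := tsmooth_cmp cv_smooth S.smooth_T
  have h1 := ftc le_rfl ht (fun s _ => II_deriv (Γ := Γ) s0 s) (II_cont (tsmooth_dt s0).cont)
  have h2 : 0 ≤ ∫ s in (0:ℝ)..t, -II Γ (dt (cmp cv S.T)) s := by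
    apply intervalIntegral.integral_nonneg ht
    intro s hs
    have h3 := id_heat S cv_smooth (by rw [cv_deriv]; exact cv1_zero (by simp))
      (by rw [cv_deriv]; exact cv1_zero (by simp)) hs.1
    rw [cv_deriv, cv1_deriv] at h3
    have h4 : 0 ≤ II Γ (cmp cvw S.T * (d1 S.T * d1 S.T + d2 S.T * d2 S.T)) s := by
      apply II_nonneg hΓ.le
      intro x y _
      exact mul_nonneg (cvw_nonneg _) (add_nonneg (mul_self_nonneg _) (mul_self_nonneg _))
    linarith
  rw [intervalIntegral.integral_neg, h1] at h2
  have h5 : II Γ (cmp cv S.T) 0 = II Γ (cst 0) 0 := by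
    apply II_congr
    intro x y hy
    exact cv_zero (hT0 x y hy)
  rw [h5, II_cst] at h2
  have h6 := II_zero hΓ s0.cont (per_cmp cv S.periodic_T) (t := t) (fun x y _ => cv_nonneg _)
    (by linarith) x y hy
  by_contra hcon
  have : S.T t x y < 0 ∨ 1 < S.T t x y := by
    by_contra hc
    push Not at hc
    exact hcon ⟨hc.1, hc.2⟩
  exact (cv_pos this).ne' h6

theorem poincare (hΓ : 0 < Γ) {f : TField} (hf : tsmooth f) (t : ℝ) :
    II Γ (f * f) t ≤ 2 * BB Γ 0 (f * f) t + 4 * II Γ (d2 f * d2 f) t := by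
  have hb := balance (Γ := Γ) (t := t) (A := cst 0) (X := cst 0)
    (Y := (cst 1 - RB.ht) * (f * f))
    (Z := f * f - cst 2 * ((cst 1 - RB.ht) * (f * d2 f)))
    (by apply tsmooth.cont; simp (maxDischargeDepth := 20)) (by simp (maxDischargeDepth := 20)) (by simp (maxDischargeDepth := 20) [hf])
    (by apply tsmooth.cont; simp (maxDischargeDepth := 20) [hf]) (by simp (maxDischargeDepth := 20)) (by
      intro x y hy
      simp (maxDischargeDepth := 20) only [d1_mul, d2_mul, dt_mul, d1_add, d2_add, dt_add, d1_sub, d2_sub, dt_sub, d1_cst, d2_cst, dt_cst, d1_ht, d2_ht, dt_ht, d2_d1, d1_dt, d2_dt,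
        tsmooth_mul, tsmooth_add, tsmooth_sub, tsmooth_cst, tsmooth_ht, tsmooth_d1, tsmooth_d2, tsmooth_dt, smooth_vort, Sol.smooth_u1, Sol.smooth_u2, Sol.smooth_T, Sol.smooth_p,
        Pi.add_apply, Pi.sub_apply, Pi.mul_apply, cst, hf]
      simp only [RB.ht]
      ring)
  have h1 : BB Γ 1 ((cst 1 - RB.ht) * (f * f)) t = BB Γ 1 (cst 0) t := by
    apply BB_congr; intro x; simp [cst, RB.ht]
  have h0 : BB Γ 0 ((cst 1 - RB.ht) * (f * f)) t = BB Γ 0 (f * f) t := by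
    apply BB_congr; intro x; simp [cst, RB.ht]
  have h2 : II Γ (cst (1/2) * (f * f) - cst 2 * (d2 f * d2 f)) t
      ≤ II Γ (f * f - cst 2 * ((cst 1 - RB.ht) * (f * d2 f))) t := by
    apply II_mono hΓ.le (by apply tsmooth.cont; simp (maxDischargeDepth := 20) [hf]) (by apply tsmooth.cont; simp (maxDischargeDepth := 20) [hf])
    intro x y hy
    simp only [Pi.sub_apply, Pi.mul_apply, cst, RB.ht]
    have hy0 := hy.1
    have hy1 := hy.2
    have hw : (1 - y)^2 ≤ 1 := by nlinarith
    have hd2 := mul_self_nonneg (d2 f t x y)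
    nlinarith [sq_nonneg (f t x y - 2 * (1 - y) * d2 f t x y)]
  rw [h1, h0, BB_cst, II_cst] at hb
  rw [II_sub' (by simp (maxDischargeDepth := 20) [hf]) (by simp (maxDischargeDepth := 20) [hf]), II_smul, II_smul] at h2
  linarith
end

section
theorem limsup_final {a p1 p0 n : ℝ → ℝ} {l r C K : ℝ} (hl : 0 ≤ l) (hr : 0 ≤ r)
    (h1 : ∀ᶠ t in atTop, a t ≤ l * (p1 t + p0 t) + r * n t + C * (1 / t))
    (h2 : ∀ᶠ t in atTop, n t ≤ K) (h2' : ∀ᶠ t in atTop, -(K * (1 / t)) ≤ n t)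
    (h3 : ∀ M, 0 ≤ M → (∀ᶠ t in atTop, a t ≤ M) →
      ∃ k, ∀ᶠ t in atTop, |p1 t| ≤ k ∧ |p0 t| ≤ k)
    (h4 : ∀ᶠ t in atTop, 0 ≤ a t) :
    limsup a atTop ≤ l * |limsup p1 atTop + limsup p0 atTop| + limsup n atTop * r := by
  have hinv : Tendsto (fun t : ℝ => 1 / t) atTop (nhds 0) := by
    simpa using tendsto_inv_atTop_zero (𝕜 := ℝ)
  have hK : Tendsto (fun t : ℝ => K * (1 / t)) atTop (nhds 0) := by
    simpa using hinv.const_mul K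
  have hCt : Tendsto (fun t : ℝ => C * (1 / t)) atTop (nhds 0) := by
    simpa using hinv.const_mul C
  have nb : IsBoundedUnder (· ≤ ·) atTop n := ⟨K, by simpa using h2⟩
  have up : ∀ {f : ℝ → ℝ}, IsBoundedUnder (· ≤ ·) atTop f → ∀ ε > 0,
      ∀ᶠ t in atTop, f t < limsup f atTop + ε := by
    intro f hf ε hε
    exact eventually_lt_of_limsup_lt (by linarith) hf
  have hn0 : 0 ≤ limsup n atTop := by
    by_contra hcon
    push Not at hcon
    have e1 := up nb (-(limsup n atTop) / 2) (by linarith)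
    have e2 : ∀ᶠ t in atTop, K * (1 / t) < -(limsup n atTop) / 2 :=
      hK.eventually_lt_const (by linarith)
    obtain ⟨t, t1, t2, t3⟩ := (e1.and (e2.and h2')).exists
    linarith
  by_cases hb : ∃ M, 0 ≤ M ∧ ∀ᶠ t in atTop, a t ≤ M
  · obtain ⟨M, hM, hMa⟩ := hb
    obtain ⟨k, hk⟩ := h3 M hM hMa
    have b1 : IsBoundedUnder (· ≤ ·) atTop p1 :=
      ⟨k, by simpa using hk.mono fun t h => (abs_le.1 h.1).2⟩
    have b0 : IsBoundedUnder (· ≤ ·) atTop p0 :=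
      ⟨k, by simpa using hk.mono fun t h => (abs_le.1 h.2).2⟩
    have cb : IsCoboundedUnder (· ≤ ·) atTop a :=
      IsBoundedUnder.isCoboundedUnder_le ⟨0, by simpa using h4⟩
    apply le_of_forall_pos_le_add
    intro ε hε
    set d := ε / (2 * l + r + 1) with hd
    have hden : 0 < 2 * l + r + 1 := by positivity
    have hdp : 0 < d := by positivity
    apply limsup_le_of_le cb
    filter_upwards [h1, up b1 d hdp, up b0 d hdp, up nb d hdp, hCt.eventually_lt_const hdp]
      with t q1 q2 q3 q4 q5
    have s1 : l * (p1 t + p0 t) ≤ l * (limsup p1 atTop + limsup p0 atTop + 2 * d) :=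
      mul_le_mul_of_nonneg_left (by linarith) hl
    have s2 : r * n t ≤ r * (limsup n atTop + d) := mul_le_mul_of_nonneg_left (by linarith) hr
    have s3 : l * (limsup p1 atTop + limsup p0 atTop) ≤ l * |limsup p1 atTop + limsup p0 atTop| :=
      mul_le_mul_of_nonneg_left (le_abs_self _) hl
    have s4 : d * (2 * l + r + 1) = ε := by rw [hd]; field_simp
    linarith
  · have : limsup a atTop = 0 := by
      rw [limsup_eq]
      have : {b | ∀ᶠ t in atTop, a t ≤ b} = ∅ := by
        ext b
        simp only [mem_setOf_eq, mem_empty_iff_false, iff_false]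
        intro h
        exact hb ⟨max b 0, le_max_right _ _, h.mono fun t ht => ht.trans (le_max_left _ _)⟩
      rw [this, Real.sInf_empty]
    rw [this]
    positivity

theorem avg_conv {Γ : ℝ} (hΓ : 0 < Γ) (f : ℝ → ℝ → ℝ) {t : ℝ} (ht : 0 < t) :
    (1/t) * ∫ s in Ioc (0:ℝ) t, (1/Γ) * ∫ x1 in Ioc (0:ℝ) Γ, f s x1
      = (1/Γ) * ((1/t) * ∫ s in (0:ℝ)..t, ∫ x1 in (0:ℝ)..Γ, f s x1) := by
  rw [integral_const_mul, intervalIntegral.integral_of_le ht.le]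
  simp only [intervalIntegral.integral_of_le hΓ.le]
  ring
end

section
set_option linter.unusedSimpArgs false

variable {Γ Ra Pr : ℝ} {Ls : ℝ≥0∞} (S : Sol Γ Ra Pr Ls)

/-! ### The scalar functions of time -/
def fe : ℝ → ℝ := II Γ (vort S * vort S)
def fD : ℝ → ℝ := II Γ (d1 (vort S) * d1 (vort S) + d2 (vort S) * d2 (vort S))
def fy : ℝ → ℝ := II Γ (S.u1 * S.u1 + S.u2 * S.u2)
def fb (c : ℝ) : ℝ → ℝ := BB Γ c (S.u1 * S.u1)
def fN : ℝ → ℝ := II Γ (S.u2 * S.T)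
def fth : ℝ → ℝ := II Γ (d1 S.T * d1 S.T + d2 S.T * d2 S.T)
def fP (c : ℝ) : ℝ → ℝ := BB Γ c (S.p * d1 S.u1)
def fW : ℝ → ℝ := II Γ (vort S * d1 S.T)
def fq : ℝ → ℝ := II Γ (cst (1/2) * (S.T * S.T) - (cst 1 - RB.ht) * S.T)
def fG : ℝ → ℝ := fun t => Pr⁻¹ * (1/2) * (fe S t + (Ls⁻¹).toReal * (fb S 1 t + fb S 0 t))
def fG1 : ℝ → ℝ := fun t => Pr⁻¹ * (1/2) * (II Γ ((cst 0 + cst 1 * RB.ht) * (vort S * vort S)) t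
  + (Ls⁻¹).toReal * fb S 1 t)
def fR : ℝ → ℝ := fun t => -II Γ ((cst 0 + cst 1 * RB.ht) *
          (d1 (vort S) * d1 (vort S) + d2 (vort S) * d2 (vort S) - cst Ra * (vort S * d1 S.T))
        + cst 1 * (vort S * d2 (vort S) - cst (Pr⁻¹ * (1/2)) * (S.u2 * (vort S * vort S)))) t

theorem dG_raw (t : ℝ) : HasDerivAt (fG S) (Pr⁻¹ * (1/2) * (II Γ (dt (vort S * vort S)) t
    + (Ls⁻¹).toReal * (BB Γ 1 (dt (S.u1 * S.u1)) t + BB Γ 0 (dt (S.u1 * S.u1)) t))) t := by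
  have h1 := II_deriv (Γ := Γ) (F := vort S * vort S) (by simp (maxDischargeDepth := 20)) t
  have h2 := BB_deriv (Γ := Γ) (F := S.u1 * S.u1) (by simp (maxDischargeDepth := 20)) 1 t
  have h3 := BB_deriv (Γ := Γ) (F := S.u1 * S.u1) (by simp (maxDischargeDepth := 20)) 0 t
  exact (h1.add ((h2.add h3).const_mul _)).const_mul _

theorem G_enst {t : ℝ} (ht : 0 ≤ t) :
    Pr⁻¹ * (1/2) * (II Γ (dt (vort S * vort S)) t
    + (Ls⁻¹).toReal * (BB Γ 1 (dt (S.u1 * S.u1)) t + BB Γ 0 (dt (S.u1 * S.u1)) t))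
      = (Ls⁻¹).toReal * (fP S 1 t + fP S 0 t) - fD S t + Ra * fW S t := by
  have h := id_enst S 1 0 ht
  have e1 : ∀ F : TField, (cst 1 + cst 0 * RB.ht) * F = F := by
    intro F; funext t x y; simp [cst]
  have e2 : ∀ F G : TField, F + cst 0 * G = F := by
    intro F G; funext t x y; simp [cst]
  have e3 : ∀ F : TField, cst 1 * F = F := by
    intro F; funext t x y; simp [cst]
  simp only [e1, e2, e3] at h
  rw [II_sub' (by simp (maxDischargeDepth := 20)) (by simp (maxDischargeDepth := 20)), II_smul] at h
  unfold fP fD fW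
  linarith

theorem Nle_aux (hΓ : 0 < Γ) (hT : ∀ t x y, 0 ≤ t → y ∈ Icc (0:ℝ) 1 → S.T t x y ∈ Icc (0:ℝ) 1)
    {t : ℝ} (ht : 0 ≤ t) {d : ℝ} (hd : 0 < d) :
    |fN S t| ≤ (1/2) * (d * fy S t + Γ / d) := by
  have key : ∀ x y, y ∈ Icc (0:ℝ) 1 → |S.u2 t x y * S.T t x y| ≤
      1/2 * (d * (S.u1 t x y * S.u1 t x y + S.u2 t x y * S.u2 t x y) + 1 / d) := by
    intro x y hy
    have h1 := hT t x y ht hy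
    have hp : 0 < 1 / d := by positivity
    have h3 : |S.u2 t x y * S.T t x y| ≤ |S.u2 t x y| := by
      rw [abs_mul, abs_of_nonneg h1.1]
      exact mul_le_of_le_one_right (abs_nonneg _) h1.2
    have h4 : |S.u2 t x y| ≤ 1/2 * (d * (S.u2 t x y * S.u2 t x y) + 1 / d) := by
      have h5 : 1/2 * (d * (S.u2 t x y * S.u2 t x y) + 1 / d) - |S.u2 t x y|
          = (d * |S.u2 t x y| - 1)^2 / (2 * d) := by
        rw [← abs_mul_abs_self (S.u2 t x y)]; field_simp; ring
      have h6 : 0 ≤ (d * |S.u2 t x y| - 1)^2 / (2 * d) := by positivity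
      linarith
    have h7 := mul_nonneg hd.le (mul_self_nonneg (S.u1 t x y))
    nlinarith
  have up : II Γ (S.u2 * S.T) t ≤ II Γ (cst (1/2) * (cst d * (S.u1 * S.u1 + S.u2 * S.u2)
      + cst (1/d))) t := by
    apply II_mono hΓ.le (by apply tsmooth.cont; simp (maxDischargeDepth := 20)) (by apply tsmooth.cont; simp (maxDischargeDepth := 20))
    exact fun x y hy => (abs_le.1 (key x y hy)).2
  have lo : II Γ (cst (-1) * (S.u2 * S.T)) t ≤ II Γ (cst (1/2) * (cst d * (S.u1 * S.u1 + S.u2 * S.u2)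
      + cst (1/d))) t := by
    apply II_mono hΓ.le (by apply tsmooth.cont; simp (maxDischargeDepth := 20)) (by apply tsmooth.cont; simp (maxDischargeDepth := 20))
    intro x y hy
    have := (abs_le.1 (key x y hy)).1
    simp only [Pi.mul_apply, Pi.add_apply, cst]
    linarith
  rw [II_smul, II_smul, II_add' (by simp (maxDischargeDepth := 20)) (by simp (maxDischargeDepth := 20)), II_smul, II_cst] at lo
  rw [II_smul, II_add' (by simp (maxDischargeDepth := 20)) (by simp (maxDischargeDepth := 20)), II_smul, II_cst] at up
  unfold fN fy
  have : 1 / d * Γ = Γ / d := by ring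
  rw [this] at up lo
  rw [abs_le]
  constructor <;> linarith

theorem yle_aux (hΓ : 0 < Γ) {t : ℝ} (ht : 0 ≤ t) :
    fy S t ≤ 2 * fb S 0 t + 4 * fe S t := by
  have h1 := poincare hΓ S.smooth_u1 t
  have h2 := poincare hΓ S.smooth_u2 t
  have h3 : BB Γ 0 (S.u2 * S.u2) t = BB Γ 0 (cst 0) t := by
    apply BB_congr; intro x; simp [cst, bdy_u2 S (Or.inl rfl) ht]
  rw [h3, BB_cst] at h2
  have h4 := id_grad S ht
  have h5 : II Γ (d2 S.u1 * d2 S.u1 + d2 S.u2 * d2 S.u2) t ≤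
      II Γ (d1 S.u1 * d1 S.u1 + d2 S.u1 * d2 S.u1 + d1 S.u2 * d1 S.u2 + d2 S.u2 * d2 S.u2) t := by
    apply II_mono hΓ.le (by apply tsmooth.cont; simp (maxDischargeDepth := 20)) (by apply tsmooth.cont; simp (maxDischargeDepth := 20))
    intro x y hy
    simp only [Pi.mul_apply, Pi.add_apply]
    linarith [mul_self_nonneg (d1 S.u1 t x y), mul_self_nonneg (d1 S.u2 t x y)]
  rw [h4, II_add' (by simp (maxDischargeDepth := 20)) (by simp (maxDischargeDepth := 20))] at h5
  unfold fy fb fe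
  rw [II_add' (by simp (maxDischargeDepth := 20)) (by simp (maxDischargeDepth := 20))]
  linarith

theorem W_aux (hΓ : 0 < Γ) {a b : ℝ} (hb : 0 ≤ b) (hab : 1 ≤ a * b * 4) (t : ℝ) :
    |fW S t| ≤ a * fe S t + b * fth S t := by
  have key : ∀ x y, |vort S t x y * d1 S.T t x y| ≤ a * (vort S t x y * vort S t x y)
      + b * (d1 S.T t x y * d1 S.T t x y + d2 S.T t x y * d2 S.T t x y) := by
    intro x y
    have hb' : 0 < b := by
      rcases hb.lt_or_eq with h | h
      · exact h
      · rw [← h] at hab; norm_num at hab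
    have h7 := mul_nonneg hb (mul_self_nonneg (d2 S.T t x y))
    set w := |vort S t x y| with hw
    set z := |d1 S.T t x y| with hz
    rw [abs_mul, ← abs_mul_abs_self (vort S t x y), ← abs_mul_abs_self (d1 S.T t x y), ← hw, ← hz]
    have h8 : 0 ≤ b * (a * (w * w) + b * (z * z) - w * z) := by
      nlinarith [sq_nonneg (2 * b * z - w), mul_self_nonneg w]
    have h9 : 0 ≤ a * (w * w) + b * (z * z) - w * z := nonneg_of_mul_nonneg_right h8 hb'
    linarith
  have up : II Γ (vort S * d1 S.T) t ≤ II Γ (cst a * (vort S * vort S)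
      + cst b * (d1 S.T * d1 S.T + d2 S.T * d2 S.T)) t := by
    apply II_mono hΓ.le (by apply tsmooth.cont; simp (maxDischargeDepth := 20)) (by apply tsmooth.cont; simp (maxDischargeDepth := 20))
    exact fun x y _ => (abs_le.1 (key x y)).2
  have lo : II Γ (cst (-1) * (vort S * d1 S.T)) t ≤ II Γ (cst a * (vort S * vort S)
      + cst b * (d1 S.T * d1 S.T + d2 S.T * d2 S.T)) t := by
    apply II_mono hΓ.le (by apply tsmooth.cont; simp (maxDischargeDepth := 20)) (by apply tsmooth.cont; simp (maxDischargeDepth := 20))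
    intro x y _
    have := (abs_le.1 (key x y)).1
    simp only [Pi.mul_apply, Pi.add_apply, cst]
    linarith
  rw [II_add' (by simp (maxDischargeDepth := 20)) (by simp (maxDischargeDepth := 20)), II_smul, II_smul] at up
  rw [II_smul, II_add' (by simp (maxDischargeDepth := 20)) (by simp (maxDischargeDepth := 20)), II_smul, II_smul] at lo
  unfold fW fe fth
  rw [abs_le]
  constructor <;> linarith

theorem dat (hΓ : 0 < Γ) (hRa : 0 < Ra) (hPr : 0 < Pr) (hT0 : T0cond S) :
    Dat Γ Ra Pr (Ls⁻¹).toReal (fe S) (fD S) (fy S) (fb S 1) (fb S 0) (fN S) (fth S) (fP S 1) (fP S 0)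
      (fG S) (fG1 S) (fq S) (fR S) (fW S) := by
  have hT := T_range S hΓ hT0
  have hl : 0 ≤ (Ls⁻¹).toReal := ENNReal.toReal_nonneg
  have hb0 : ∀ c t, 0 ≤ fb S c t := fun c t => BB_nonneg hΓ.le fun x => mul_self_nonneg _
  have hsq : Real.sqrt Ra * Real.sqrt Ra = Ra := Real.mul_self_sqrt hRa.le
  have hsp : 0 < Real.sqrt Ra := Real.sqrt_pos.2 hRa
  constructor
  case ce => exact II_cont (by apply tsmooth.cont; simp (maxDischargeDepth := 20))
  case cD => exact II_cont (by apply tsmooth.cont; simp (maxDischargeDepth := 20))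
  case cb1 => exact BB_cont (by apply tsmooth.cont; simp (maxDischargeDepth := 20)) _
  case cb0 => exact BB_cont (by apply tsmooth.cont; simp (maxDischargeDepth := 20)) _
  case cN => exact II_cont (by apply tsmooth.cont; simp (maxDischargeDepth := 20))
  case cth => exact II_cont (by apply tsmooth.cont; simp (maxDischargeDepth := 20))
  case cP1 => exact BB_cont (by apply tsmooth.cont; simp (maxDischargeDepth := 20)) _
  case cP0 => exact BB_cont (by apply tsmooth.cont; simp (maxDischargeDepth := 20)) _
  case cR => exact (II_cont (by apply tsmooth.cont; simp (maxDischargeDepth := 20))).neg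
  case cW => exact II_cont (by apply tsmooth.cont; simp (maxDischargeDepth := 20))
  case e0 => exact fun t _ => II_nonneg hΓ.le fun x y _ => mul_self_nonneg _
  case D0 =>
    exact fun t _ => II_nonneg hΓ.le fun x y _ => add_nonneg (mul_self_nonneg _) (mul_self_nonneg _)
  case y0 =>
    exact fun t _ => II_nonneg hΓ.le fun x y _ => add_nonneg (mul_self_nonneg _) (mul_self_nonneg _)
  case b10 => exact fun t _ => hb0 1 t
  case b00 => exact fun t _ => hb0 0 t
  case th0 =>
    exact fun t _ => II_nonneg hΓ.le fun x y _ => add_nonneg (mul_self_nonneg _) (mul_self_nonneg _)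
  case dy =>
    intro t ht
    have h := II_deriv (Γ := Γ) (F := S.u1 * S.u1 + S.u2 * S.u2) (by simp (maxDischargeDepth := 20)) t
    have he := id_energy S ht
    have e : II Γ (dt (S.u1 * S.u1 + S.u2 * S.u2)) t
        = 2 * Pr * (Pr⁻¹ * (1/2) * II Γ (dt (S.u1 * S.u1 + S.u2 * S.u2)) t) := by field_simp
    have e2 : Pr⁻¹ * (1/2) * II Γ (dt (S.u1 * S.u1 + S.u2 * S.u2)) t
      = Ra * fN S t - (fe S t + (Ls⁻¹).toReal * (fb S 1 t + fb S 0 t)) := by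
      unfold fN fe fb; linarith
    rw [e2] at e
    rw [e] at h
    exact h
  case yle => exact fun t ht => yle_aux S hΓ ht
  case Nle => exact fun t ht d hd => Nle_aux S hΓ hT ht hd
  case dq =>
    intro t ht
    have h := II_deriv (Γ := Γ) (F := cst (1/2) * (S.T * S.T) - (cst 1 - RB.ht) * S.T) (by simp (maxDischargeDepth := 20)) t
    have he := id_nusselt S ht
    rw [II_sub' (F := S.u2 * S.T) (by simp (maxDischargeDepth := 20)) (by simp (maxDischargeDepth := 20)), id_d2T S ht] at he
    have e : II Γ (dt (cst (1/2) * (S.T * S.T) - (cst 1 - RB.ht) * S.T)) t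
        = fN S t + Γ - fth S t := by unfold fN fth; linarith
    rw [e] at h
    exact h
  case qle =>
    intro t ht
    have key : ∀ x y, y ∈ Icc (0:ℝ) 1 →
        |1/2 * (S.T t x y * S.T t x y) - (1 - y) * S.T t x y| ≤ 1 := by
      intro x y hy
      have h1 := hT t x y ht hy
      obtain ⟨a1, a2⟩ := h1
      obtain ⟨y1, y2⟩ := hy
      have c1 : S.T t x y * S.T t x y ≤ 1 := by nlinarith
      have c2 : 0 ≤ (1 - y) * S.T t x y := mul_nonneg (by linarith) a1
      have c3 : (1 - y) * S.T t x y ≤ 1 := by nlinarith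
      have c4 := mul_self_nonneg (S.T t x y)
      rw [abs_le]; constructor <;> linarith
    have up : fq S t ≤ II Γ (cst 1) t := by
      apply II_mono hΓ.le (by apply tsmooth.cont; simp (maxDischargeDepth := 20)) (by apply tsmooth.cont; simp (maxDischargeDepth := 20))
      exact fun x y hy => (abs_le.1 (key x y hy)).2
    have lo : II Γ (cst (-1)) t ≤ fq S t := by
      apply II_mono hΓ.le (by apply tsmooth.cont; simp (maxDischargeDepth := 20)) (by apply tsmooth.cont; simp (maxDischargeDepth := 20))
      exact fun x y hy => (abs_le.1 (key x y hy)).1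
    rw [II_cst] at up lo
    rw [abs_le]; constructor <;> linarith
  case Geq => exact fun t => rfl
  case dG =>
    intro t ht
    have := dG_raw S t
    rw [G_enst S ht] at this
    exact this
  case Wle =>
    intro t ht
    have h := W_aux S hΓ (a := 1 / (2 * Real.sqrt Ra)) (b := Real.sqrt Ra / 2) (by positivity)
      (by field_simp; norm_num) t
    have h2 := mul_le_mul_of_nonneg_left ((le_abs_self _).trans h) hRa.le
    have h3 : Ra * (1 / (2 * Real.sqrt Ra)) = 1/2 * Real.sqrt Ra := by
      rw [← hsq]
      simp only [Real.sqrt_mul_self hsp.le]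
      field_simp
    calc Ra * fW S t ≤ _ := h2
      _ = (Ra * (1 / (2 * Real.sqrt Ra))) * fe S t + 1/2 * (Ra * Real.sqrt Ra * fth S t) := by ring
      _ = _ := by rw [h3]; ring
  case Wabs =>
    intro t ht
    have h := W_aux S hΓ (a := 1) (b := 1) (by norm_num) (by norm_num) t
    linarith
  case dG1 =>
    intro t ht
    have h1 := II_deriv (Γ := Γ) (F := (cst 0 + cst 1 * RB.ht) * (vort S * vort S)) (by simp (maxDischargeDepth := 20)) t
    have h2 := BB_deriv (Γ := Γ) (F := S.u1 * S.u1) (by simp (maxDischargeDepth := 20)) 1 t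
    have h3 := (h1.add (h2.const_mul (Ls⁻¹).toReal)).const_mul (Pr⁻¹ * (1/2))
    have h4 := id_enst S 0 1 ht
    have e : Pr⁻¹ * (1/2) * (II Γ (dt ((cst 0 + cst 1 * RB.ht) * (vort S * vort S))) t
      + (Ls⁻¹).toReal * BB Γ 1 (dt (S.u1 * S.u1)) t) = (Ls⁻¹).toReal * fP S 1 t + fR S t := by
      unfold fP fR; linarith
    rw [e] at h3
    exact h3
  case G10 =>
    intro t ht
    have h1 : 0 ≤ II Γ ((cst 0 + cst 1 * RB.ht) * (vort S * vort S)) t := by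
      apply II_nonneg hΓ.le
      intro x y hy
      refine mul_nonneg ?_ (mul_self_nonneg _)
      simp only [Pi.mul_apply, Pi.add_apply, cst, RB.ht]; linarith [hy.1]
    have h2 := hb0 1 t
    unfold fG1
    positivity
  case G1le =>
    intro t ht
    have h1 : II Γ ((cst 0 + cst 1 * RB.ht) * (vort S * vort S)) t ≤ fe S t := by
      apply II_mono hΓ.le (by apply tsmooth.cont; simp (maxDischargeDepth := 20)) (by apply tsmooth.cont; simp (maxDischargeDepth := 20))
      intro x y hy
      simp only [Pi.mul_apply, Pi.add_apply, cst, RB.ht]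
      have := mul_self_nonneg (vort S t x y)
      nlinarith [hy.2]
    have h2 := mul_nonneg hl (hb0 0 t)
    unfold fG1 fG
    apply mul_le_mul_of_nonneg_left _ (by positivity)
    linarith
end

section
set_option linter.unusedSimpArgs false

variable {Γ Ra Pr : ℝ} {Ls : ℝ≥0∞} (S : Sol Γ Ra Pr Ls)

/-! ### Bounds for the localized pressure identity and for the growth of the enstrophy -/

theorem R_point {y w a b T1 T2 u v r c m : ℝ} (hy : y ∈ Icc (0:ℝ) 1) (hr : 0 ≤ r) (hc : 0 ≤ c)
    (hm : 0 < m) :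
    |(0 + 1 * y) * (a * a + b * b - r * (w * T1)) + 1 * (w * b - c * (v * (w * w)))| ≤
      3/2 * (a * a + b * b) + (r/2 + 1/2) * (w * w) + r/2 * (T1 * T1 + T2 * T2)
        + c * (m/2 * (u * u + v * v) + 1/(2*m) * (w * w * (w * w))) := by
  obtain ⟨y0, y1⟩ := hy
  have hp := mul_self_nonneg w
  have h1 : |y * (a * a + b * b)| ≤ a * a + b * b := by
    rw [abs_of_nonneg (mul_nonneg y0 (add_nonneg (mul_self_nonneg a) (mul_self_nonneg b)))]
    nlinarith [mul_self_nonneg a, mul_self_nonneg b]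
  have h2 : |y * (r * (w * T1))| ≤ r/2 * (w * w) + r/2 * (T1 * T1) := by
    have e1 : |w * T1| ≤ 1/2 * (w * w) + 1/2 * (T1 * T1) := by
      rw [abs_le]; constructor <;> nlinarith [sq_nonneg (w - T1), sq_nonneg (w + T1)]
    rw [abs_mul, abs_mul, abs_of_nonneg y0, abs_of_nonneg hr]
    have e2 : y * (r * |w * T1|) ≤ r * |w * T1| := mul_le_of_le_one_left (by positivity) y1
    have e3 := mul_le_mul_of_nonneg_left e1 hr
    linarith
  have h3 : |w * b| ≤ 1/2 * (w * w) + 1/2 * (b * b) := by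
    rw [abs_le]; constructor <;> nlinarith [sq_nonneg (w - b), sq_nonneg (w + b)]
  have h4 : |c * (v * (w * w))| ≤ c * (m/2 * (u * u + v * v) + 1/(2*m) * (w * w * (w * w))) := by
    rw [abs_mul, abs_of_nonneg hc]
    apply mul_le_mul_of_nonneg_left _ hc
    set z := w * w
    have e1 : m/2 * (u * u + v * v) + 1/(2*m) * (z * z) - v * z
        = m/2 * (u * u) + (m * v - z)^2 / (2 * m) := by field_simp; ring
    have e2 : m/2 * (u * u + v * v) + 1/(2*m) * (z * z) + v * z
        = m/2 * (u * u) + (m * v + z)^2 / (2 * m) := by field_simp; ring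
    have e3 : 0 ≤ m/2 * (u * u) := mul_nonneg (by positivity) (mul_self_nonneg u)
    have e4 : 0 ≤ (m * v - z)^2 / (2 * m) := by positivity
    have e5 : 0 ≤ (m * v + z)^2 / (2 * m) := by positivity
    rw [abs_le]; constructor <;> linarith
  have h5 : 0 ≤ r/2 * (T2 * T2) := mul_nonneg (by positivity) (mul_self_nonneg _)
  have h6 := mul_self_nonneg a
  rw [abs_le] at *
  constructor <;> linarith [h1.1, h1.2, h2.1, h2.2, h3.1, h3.2, h4.1, h4.2]

theorem R_bound (hΓ : 0 < Γ) (hRa : 0 < Ra) (hPr : 0 < Pr) {Y t : ℝ} (hY : fy S t ≤ Y) (hY0 : 0 ≤ Y) :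
    |fR S t| ≤ (2 + Ra + Pr⁻¹ * (1/2) * (Y/2 + (1/Γ + 1))) * (1 + fD S t + fe S t + fth S t) := by
  have he : 0 ≤ fe S t := II_nonneg hΓ.le fun x y _ => mul_self_nonneg _
  have hD : 0 ≤ fD S t :=
    II_nonneg hΓ.le fun x y _ => add_nonneg (mul_self_nonneg _) (mul_self_nonneg _)
  have hth : 0 ≤ fth S t :=
    II_nonneg hΓ.le fun x y _ => add_nonneg (mul_self_nonneg _) (mul_self_nonneg _)
  have hw1 : 0 ≤ II Γ (d1 (vort S) * d1 (vort S)) t := II_nonneg hΓ.le fun x y _ => mul_self_nonneg _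
  have hw2 : 0 ≤ II Γ (d2 (vort S) * d2 (vort S)) t := II_nonneg hΓ.le fun x y _ => mul_self_nonneg _
  have hDs : fD S t = II Γ (d1 (vort S) * d1 (vort S)) t + II Γ (d2 (vort S) * d2 (vort S)) t := by
    unfold fD; rw [II_add' (by simp (maxDischargeDepth := 20)) (by simp (maxDischargeDepth := 20))]
  set m : ℝ := 1 + fe S t + fD S t with hm
  have hm0 : 0 < m := by positivity
  have hc : 0 ≤ Pr⁻¹ * (1/2) := by positivity
  have hQ : II Γ (vort S * vort S * (vort S * vort S)) t ≤ (2 * m) * ((1/Γ + 1) * m) := by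
    have h := lad hΓ (smooth_vort S) (smooth_vort S) one_pos one_pos t
    rw [II_add' (by simp (maxDischargeDepth := 20)) (by simp (maxDischargeDepth := 20)), II_add' (by simp (maxDischargeDepth := 20)) (by simp (maxDischargeDepth := 20)), II_smul, II_smul, II_smul, II_smul] at h
    refine h.trans ?_
    have hg : 0 < 1/Γ := by positivity
    have a1 : (1 + 1) * II Γ (vort S * vort S) t + 1/1 * II Γ (d2 (vort S) * d2 (vort S)) t ≤ 2 * m := by
      have : fe S t = II Γ (vort S * vort S) t := rfl
      rw [← this]; linarith
    have a2 : (1/Γ + 1) * II Γ (vort S * vort S) t + 1/1 * II Γ (d1 (vort S) * d1 (vort S)) t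
        ≤ (1/Γ + 1) * m := by
      have : fe S t = II Γ (vort S * vort S) t := rfl
      rw [← this]
      have : 0 ≤ 1/Γ * (1 + fD S t) := by positivity
      rw [hm]; linarith
    have a3 : 0 ≤ (1/Γ + 1) * II Γ (vort S * vort S) t + 1/1 * II Γ (d1 (vort S) * d1 (vort S)) t := by
      have : fe S t = II Γ (vort S * vort S) t := rfl
      rw [← this]; positivity
    exact mul_le_mul a1 a2 a3 (by positivity)
  set F : TField := cst (3/2) * (d1 (vort S) * d1 (vort S) + d2 (vort S) * d2 (vort S))
    + cst (Ra/2 + 1/2) * (vort S * vort S) + cst (Ra/2) * (d1 S.T * d1 S.T + d2 S.T * d2 S.T)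
    + cst (Pr⁻¹ * (1/2)) * (cst (m/2) * (S.u1 * S.u1 + S.u2 * S.u2)
      + cst (1/(2*m)) * (vort S * vort S * (vort S * vort S))) with hF
  set Z : TField := ((cst 0 + cst 1 * RB.ht) *
          (d1 (vort S) * d1 (vort S) + d2 (vort S) * d2 (vort S) - cst Ra * (vort S * d1 S.T))
        + cst 1 * (vort S * d2 (vort S) - cst (Pr⁻¹ * (1/2)) * (S.u2 * (vort S * vort S)))) with hZ
  have sF : tsmooth F := by rw [hF]; simp (maxDischargeDepth := 20)
  have sZ : tsmooth Z := by rw [hZ]; simp (maxDischargeDepth := 20)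
  have key : ∀ x y, y ∈ Icc (0:ℝ) 1 → |Z t x y| ≤ F t x y := fun x y hy =>
    R_point (y := y) (w := vort S t x y) (a := d1 (vort S) t x y) (b := d2 (vort S) t x y)
      (T1 := d1 S.T t x y) (T2 := d2 S.T t x y) (u := S.u1 t x y) (v := S.u2 t x y) hy hRa.le hc hm0
  have up : II Γ Z t ≤ II Γ F t :=
    II_mono hΓ.le sZ.cont sF.cont fun x y hy => (abs_le.1 (key x y hy)).2
  have lo : II Γ (cst (-1) * F) t ≤ II Γ Z t := by
    apply II_mono hΓ.le (by apply tsmooth.cont; simp [sF]) sZ.cont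
    intro x y hy
    have := (abs_le.1 (key x y hy)).1
    simp only [Pi.mul_apply, cst]
    linarith
  rw [II_smul] at lo
  have hFv : II Γ F t = 3/2 * fD S t + (Ra/2 + 1/2) * fe S t + Ra/2 * fth S t
      + Pr⁻¹ * (1/2) * (m/2 * fy S t + 1/(2*m) * II Γ (vort S * vort S * (vort S * vort S)) t) := by
    rw [hF, II_add' (by simp (maxDischargeDepth := 20)) (by simp (maxDischargeDepth := 20)), II_add' (by simp (maxDischargeDepth := 20)) (by simp (maxDischargeDepth := 20)), II_add' (by simp (maxDischargeDepth := 20)) (by simp (maxDischargeDepth := 20)), II_smul,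
      II_smul, II_smul, II_smul, II_add' (F := cst (m/2) * (S.u1 * S.u1 + S.u2 * S.u2)) (by simp (maxDischargeDepth := 20)) (by simp (maxDischargeDepth := 20)),
      II_smul, II_smul]
    rfl
  have hb : m/2 * fy S t + 1/(2*m) * II Γ (vort S * vort S * (vort S * vort S)) t
      ≤ (Y/2 + (1/Γ + 1)) * m := by
    have b1 := mul_le_mul_of_nonneg_left hY (by positivity : 0 ≤ m/2)
    have b2 := mul_le_mul_of_nonneg_left hQ (by positivity : 0 ≤ 1/(2*m))
    have b3 : 1/(2*m) * ((2 * m) * ((1/Γ + 1) * m)) = (1/Γ + 1) * m := by field_simp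
    rw [b3] at b2
    linarith
  have hb2 := mul_le_mul_of_nonneg_left hb hc
  have hfin : II Γ F t ≤
      (2 + Ra + Pr⁻¹ * (1/2) * (Y/2 + (1/Γ + 1))) * (1 + fD S t + fe S t + fth S t) := by
    rw [hFv]
    have c1 : 0 ≤ Pr⁻¹ * (1/2) * (Y/2 + (1/Γ + 1)) * fth S t := by positivity
    have c2 : 0 ≤ Ra * fe S t := by positivity
    have c3 : 0 ≤ Ra * fD S t := by positivity
    have c4 : 0 ≤ Ra * fth S t := by positivity
    rw [hm] at hb2
    linarith
  have hR : fR S t = -II Γ Z t := rfl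
  rw [hR, abs_neg, abs_le]
  constructor <;> linarith

theorem lad_u (hΓ : 0 < Γ) {f : TField} (hf : tsmooth f) {t Y m : ℝ} (hY0 : 0 ≤ Y)
    (hfY : II Γ (f * f) t ≤ Y) (hfe : II Γ (d2 f * d2 f) t ≤ fe S t) (hm : 1 ≤ m) :
    II Γ (f * f * (vort S * vort S)) t ≤ (2 * Y + 1) * (1/Γ + 1) * (1 + fe S t)
      * (1 + fe S t + m + fD S t / m) := by
  have hm0 : 0 < m := by linarith
  have he : 0 ≤ fe S t := II_nonneg hΓ.le fun x y _ => mul_self_nonneg _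
  have hD : 0 ≤ fD S t :=
    II_nonneg hΓ.le fun x y _ => add_nonneg (mul_self_nonneg _) (mul_self_nonneg _)
  have hw1 : 0 ≤ II Γ (d1 (vort S) * d1 (vort S)) t := II_nonneg hΓ.le fun x y _ => mul_self_nonneg _
  have hw2 : 0 ≤ II Γ (d2 (vort S) * d2 (vort S)) t := II_nonneg hΓ.le fun x y _ => mul_self_nonneg _
  have hDs : fD S t = II Γ (d1 (vort S) * d1 (vort S)) t + II Γ (d2 (vort S) * d2 (vort S)) t := by
    unfold fD; rw [II_add' (by simp (maxDischargeDepth := 20)) (by simp (maxDischargeDepth := 20))]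
  have hfe' : fe S t = II Γ (vort S * vort S) t := rfl
  set k : ℝ := Real.sqrt (1 + fe S t) with hk
  have hkk : k * k = 1 + fe S t := Real.mul_self_sqrt (by linarith)
  have hk1 : 1 ≤ k := Real.one_le_sqrt.2 (by linarith)
  have hk0 : 0 < k := by linarith
  have hg : 0 < 1/Γ := by positivity
  have h := lad hΓ hf (smooth_vort S) hk0 (by positivity : 0 < m/k) t
  rw [II_add' (by simp (maxDischargeDepth := 20) [hf]) (by simp (maxDischargeDepth := 20) [hf]), II_add' (by simp (maxDischargeDepth := 20)) (by simp (maxDischargeDepth := 20)), II_smul, II_smul, II_smul, II_smul,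
    ← hfe'] at h
  refine h.trans ?_
  have a1 : (1 + k) * II Γ (f * f) t + 1/k * II Γ (d2 f * d2 f) t ≤ k * (2 * Y + 1) := by
    have b1 := mul_le_mul_of_nonneg_left hfY (by positivity : 0 ≤ 1 + k)
    have b2 := mul_le_mul_of_nonneg_left hfe (by positivity : 0 ≤ 1/k)
    have b3 : 1/k * fe S t ≤ k := by
      rw [one_div, inv_mul_le_iff₀ hk0, hkk]; linarith
    have b4 : Y ≤ k * Y := le_mul_of_one_le_left hY0 hk1
    linarith
  have a2 : (1/Γ + m/k) * fe S t + 1/(m/k) * II Γ (d1 (vort S) * d1 (vort S)) t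
      ≤ k * ((1/Γ + 1) * (1 + fe S t + m + fD S t / m)) := by
    have b1 : 1/Γ * fe S t ≤ k * (1/Γ * fe S t) := le_mul_of_one_le_left (by positivity) hk1
    have b2 : m/k * fe S t ≤ k * m := by
      rw [div_mul_eq_mul_div, div_le_iff₀ hk0]
      have : k * m * k = m * (1 + fe S t) := by rw [← hkk]; ring
      rw [this]; exact mul_le_mul_of_nonneg_left (by linarith) hm0.le
    have b3 : 1/(m/k) * II Γ (d1 (vort S) * d1 (vort S)) t ≤ k * (fD S t / m) := by
      have e1 : 1/(m/k) = k * (1/m) := by field_simp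
      have e2 : fD S t / m = 1/m * fD S t := by ring
      rw [e1, e2, mul_assoc]
      exact mul_le_mul_of_nonneg_left (mul_le_mul_of_nonneg_left (by linarith) (by positivity)) hk0.le
    have b4 : 0 ≤ k * (1/Γ * (1 + m + fD S t / m) + (1 + fe S t)) := by positivity
    nlinarith
  have a3 : 0 ≤ (1/Γ + m/k) * fe S t + 1/(m/k) * II Γ (d1 (vort S) * d1 (vort S)) t := by positivity
  refine (mul_le_mul a1 a2 a3 (by positivity)).trans (le_of_eq ?_)
  rw [← hkk]; ring

theorem dt_point {P r w u v a b T : ℝ} (hP : 0 < P) (hT : T ∈ Icc (0:ℝ) 1) :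
    -1 * (P⁻¹ * (a * a + b * b + w * (u * b - v * a)) - r * (T * b)) ≤
      P⁻¹ * (1/2) * (u * u * (w * w) + v * v * (w * w)) + P * r^2 / 2 := by
  have hq : 0 < P⁻¹ := by positivity
  have hPq : P * P⁻¹ = 1 := by field_simp
  have h1 : 0 ≤ P⁻¹ * ((a - w * v)^2 + a^2) := by positivity
  have h2 : 0 ≤ P⁻¹ * (b + w * u)^2 := by positivity
  have h3 : 0 ≤ P⁻¹ * (b - P * r * T)^2 := by positivity
  have h3' : P⁻¹ * (b - P * r * T)^2 = P⁻¹ * b^2 - 2 * r * T * b + P * r^2 * T^2 := by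
    field_simp; ring
  have h4 : P * r^2 * T^2 ≤ P * r^2 := by
    apply mul_le_of_le_one_right (by positivity)
    exact pow_le_one₀ hT.1 hT.2
  rw [h3'] at h3
  linarith

theorem G_bound (hΓ : 0 < Γ) (hRa : 0 < Ra) (hPr : 0 < Pr) (hT0 : T0cond S) {Y t : ℝ} (ht : 0 ≤ t)
    (hY : fy S t ≤ Y) (hY0 : 0 ≤ Y) {m : ℝ} (hm : 1 ≤ m) :
    (Ls⁻¹).toReal * (fP S 1 t + fP S 0 t) - fD S t + Ra * fW S t ≤
      Pr⁻¹ * (Pr⁻¹ * ((2 * Y + 1) * (1/Γ + 1)) * (1 + 2 * Pr) + Pr * Ra^2 / 2 * Γ) * (1 + fG S t)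
        * (1 + fe S t + m + fD S t / m) := by
  have hT := T_range S hΓ hT0
  have hm0 : 0 < m := by linarith
  have he : 0 ≤ fe S t := II_nonneg hΓ.le fun x y _ => mul_self_nonneg _
  have hD : 0 ≤ fD S t :=
    II_nonneg hΓ.le fun x y _ => add_nonneg (mul_self_nonneg _) (mul_self_nonneg _)
  have hb0 : ∀ c t, 0 ≤ fb S c t := fun c t => BB_nonneg hΓ.le fun x => mul_self_nonneg _
  have hl : 0 ≤ (Ls⁻¹).toReal := ENNReal.toReal_nonneg
  have hq : 0 < Pr⁻¹ := by positivity
  have hys : fy S t = II Γ (S.u1 * S.u1) t + II Γ (S.u2 * S.u2) t := by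
    unfold fy; rw [II_add' (by simp (maxDischargeDepth := 20)) (by simp (maxDischargeDepth := 20))]
  have hn1 : 0 ≤ II Γ (S.u1 * S.u1) t := II_nonneg hΓ.le fun x y _ => mul_self_nonneg _
  have hn2 : 0 ≤ II Γ (S.u2 * S.u2) t := II_nonneg hΓ.le fun x y _ => mul_self_nonneg _
  have hg := id_grad S ht
  rw [II_add' (by simp (maxDischargeDepth := 20)) (by simp (maxDischargeDepth := 20)), II_add' (by simp (maxDischargeDepth := 20)) (by simp (maxDischargeDepth := 20)), II_add' (by simp (maxDischargeDepth := 20)) (by simp (maxDischargeDepth := 20))] at hg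
  have g1 : 0 ≤ II Γ (d1 S.u1 * d1 S.u1) t := II_nonneg hΓ.le fun x y _ => mul_self_nonneg _
  have g2 : 0 ≤ II Γ (d2 S.u1 * d2 S.u1) t := II_nonneg hΓ.le fun x y _ => mul_self_nonneg _
  have g3 : 0 ≤ II Γ (d1 S.u2 * d1 S.u2) t := II_nonneg hΓ.le fun x y _ => mul_self_nonneg _
  have g4 : 0 ≤ II Γ (d2 S.u2 * d2 S.u2) t := II_nonneg hΓ.le fun x y _ => mul_self_nonneg _
  have hfe' : fe S t = II Γ (vort S * vort S) t := rfl
  have l1 := lad_u S hΓ S.smooth_u1 hY0 (by linarith) (by linarith) hm (t := t)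
  have l2 := lad_u S hΓ S.smooth_u2 hY0 (by linarith) (by linarith) hm (t := t)
  have hid := id_dt S ht
  have hmono : II Γ (cst (-1) * (cst Pr⁻¹ * (dt S.u1 * dt S.u1 + dt S.u2 * dt S.u2
          + vort S * (S.u1 * dt S.u2 - S.u2 * dt S.u1)) - cst Ra * (S.T * dt S.u2))) t ≤
      II Γ (cst (Pr⁻¹ * (1/2)) * (S.u1 * S.u1 * (vort S * vort S) + S.u2 * S.u2 * (vort S * vort S))
        + cst (Pr * Ra^2 / 2)) t := by
    apply II_mono hΓ.le (by apply tsmooth.cont; simp (maxDischargeDepth := 20)) (by apply tsmooth.cont; simp (maxDischargeDepth := 20))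
    exact fun x y hy => dt_point hPr (hT t x y ht hy)
  rw [II_smul, II_add' (by simp (maxDischargeDepth := 20)) (by simp (maxDischargeDepth := 20)), II_smul, II_add' (by simp (maxDischargeDepth := 20)) (by simp (maxDischargeDepth := 20)), II_cst] at hmono
  rw [← G_enst S ht]
  set X := 1 + fe S t + m + fD S t / m with hX
  have hX1 : 1 ≤ X := by
    have : 0 ≤ fD S t / m := by positivity
    rw [hX]; linarith
  set B := (2 * Y + 1) * (1/Γ + 1) with hB
  have hB0 : 0 ≤ B := by positivity
  have hGe : fG S t = Pr⁻¹ * (1/2) * (fe S t + (Ls⁻¹).toReal * (fb S 1 t + fb S 0 t)) := rfl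
  have hG0 : 0 ≤ fG S t := by
    have := hb0 1 t
    have := hb0 0 t
    rw [hGe]; positivity
  have heG : 1 + fe S t ≤ (1 + 2 * Pr) * (1 + fG S t) := by
    have e1 : 2 * Pr * fG S t = fe S t + (Ls⁻¹).toReal * (fb S 1 t + fb S 0 t) := by
      rw [hGe]; field_simp
    have e2 := mul_nonneg hl (add_nonneg (hb0 1 t) (hb0 0 t))
    linarith
  have e1 : B * (1 + fe S t) * X ≤ B * ((1 + 2 * Pr) * (1 + fG S t)) * X :=
    mul_le_mul_of_nonneg_right (mul_le_mul_of_nonneg_left heG hB0) (by linarith)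
  have e2 : Pr * Ra^2 / 2 * Γ ≤ Pr * Ra^2 / 2 * Γ * ((1 + fG S t) * X) :=
    le_mul_of_one_le_right (by positivity) (one_le_mul_of_one_le_of_one_le (by linarith) hX1)
  have e3 : Pr⁻¹ * (1/2) * (II Γ (S.u1 * S.u1 * (vort S * vort S)) t
      + II Γ (S.u2 * S.u2 * (vort S * vort S)) t) ≤ Pr⁻¹ * (B * ((1 + 2 * Pr) * (1 + fG S t)) * X) := by
    rw [mul_assoc]
    exact mul_le_mul_of_nonneg_left (by linarith) hq.le
  calc _ = Pr⁻¹ * ((1/2) * II Γ (dt (vort S * vort S)) t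
      + (Ls⁻¹).toReal * (1/2) * (BB Γ 1 (dt (S.u1 * S.u1)) t + BB Γ 0 (dt (S.u1 * S.u1)) t)) := by ring
    _ ≤ Pr⁻¹ * (Pr⁻¹ * (B * ((1 + 2 * Pr) * (1 + fG S t)) * X)
        + Pr * Ra^2 / 2 * Γ * ((1 + fG S t) * X)) :=
      mul_le_mul_of_nonneg_left (by linarith) hq.le
    _ = _ := by ring
end

section
set_option linter.unusedSimpArgs false

theorem ltavg_eq {Γ : ℝ} (hΓ : 0 < Γ) (f : ℝ → ℝ → ℝ) (g : ℝ → ℝ)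
    (h : ∀ s, 0 ≤ s → ∫ x1 in (0:ℝ)..Γ, f s x1 = g s) :
    ltavg Γ f = limsup (fun t => (1/Γ) * ((1/t) * ∫ s in (0:ℝ)..t, g s)) atTop := by
  unfold ltavg
  apply limsup_congr
  filter_upwards [eventually_gt_atTop 0] with t ht
  rw [avg_conv hΓ f ht]
  congr 2
  apply intervalIntegral.integral_congr
  intro s hs
  rw [uIcc_of_le ht.le] at hs
  exact h s hs.1

theorem final_bound (Γ Ra Pr Ls : ℝ) (hΓ : 0 < Γ) (hRa : 0 < Ra) (hPr : 0 < Pr) (hLs : 0 < Ls)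
    (S : Sol Γ Ra Pr (ENNReal.ofReal Ls)) (hT0 : T0cond S) :
    ltavg Γ (fun t x1 => ∫ x2 in (0:ℝ)..1, (d1 (vort S) t x1 x2 ^ 2 + d2 (vort S) t x1 x2 ^ 2))
      ≤ Ls⁻¹ * |ltavg Γ (fun t x1 => S.p t x1 1 * d1 S.u1 t x1 1)
              + ltavg Γ (fun t x1 => S.p t x1 0 * d1 S.u1 t x1 0)|
        + Nu S * Ra ^ ((3:ℝ)/2) := by
  have H := dat S hΓ hRa hPr hT0
  have hll : ((ENNReal.ofReal Ls)⁻¹).toReal = Ls⁻¹ := by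
    rw [ENNReal.toReal_inv, ENNReal.toReal_ofReal hLs.le]
  rw [← hll]
  set l := ((ENNReal.ofReal Ls)⁻¹).toReal with hldef
  have hl : 0 < l := by rw [hll]; positivity
  have hpow : Ra ^ ((3:ℝ)/2) = Ra * Real.sqrt Ra := by
    rw [Real.sqrt_eq_rpow, show (3:ℝ)/2 = 1 + 1/2 by norm_num, Real.rpow_add hRa, Real.rpow_one]
  rw [hpow]
  unfold Nu
  rw [ltavg_eq hΓ _ (fD S) (by
      intro s _
      unfold fD II
      simp only [Pi.add_apply, Pi.mul_apply, pow_two]),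
    ltavg_eq hΓ (fun t x1 => S.p t x1 1 * d1 S.u1 t x1 1) (fP S 1) (fun s _ => rfl), ltavg_eq hΓ (fun t x1 => S.p t x1 0 * d1 S.u1 t x1 0) (fP S 0) (fun s _ => rfl),
    ltavg_eq hΓ (fun t x1 => ∫ x2 in (0:ℝ)..1, (S.u2 t x1 x2 * S.T t x1 x2 - d2 S.T t x1 x2)) (fun s => fN S s + Γ) (by
      intro s hs
      have h1 : II Γ (S.u2 * S.T - d2 S.T) s = fN S s + Γ := by
        rw [II_sub' (by simp (maxDischargeDepth := 20)) (by simp (maxDischargeDepth := 20)), id_d2T S hs]; unfold fN; ring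
      exact h1)]
  obtain ⟨Y, hY0, hY, hN, -⟩ := H.energy hΓ hRa hPr hl
  obtain ⟨C, hC⟩ := H.main hΓ hRa hPr hl
  have hg : 0 < 1/Γ := by positivity
  have hGi : 1/Γ * Γ = 1 := by field_simp
  refine limsup_final (C := 1/Γ * C) (K := (1/Γ) * (Y + Γ) + 2) hl.le (by positivity) ?_ ?_ ?_ ?_ ?_
  · filter_upwards [eventually_gt_atTop 0] with t ht
    have h := hC t ht.le
    have ht' : 0 ≤ 1/Γ * (1/t) := by positivity
    have h2 := mul_le_mul_of_nonneg_left h ht'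
    linarith
  · filter_upwards [eventually_gt_atTop 0] with t ht
    have h1 : ∫ s in (0:ℝ)..t, (fN S s + Γ) ≤ ∫ s in (0:ℝ)..t, (Y + Γ) := by
      apply intervalIntegral.integral_mono_on ht.le
        ((H.cN.add continuous_const).intervalIntegrable _ _) (by simp)
      intro s hs
      have h0 := (abs_le.1 (hN s hs.1)).2
      show fN S s + Γ ≤ Y + Γ
      linarith
    rw [intervalIntegral.integral_const, sub_zero, smul_eq_mul] at h1
    have h2 : (1/t) * ∫ s in (0:ℝ)..t, (fN S s + Γ) ≤ Y + Γ := by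
      rw [one_div, inv_mul_le_iff₀ ht]; exact h1
    have := mul_le_mul_of_nonneg_left h2 hg.le
    linarith
  · filter_upwards [eventually_gt_atTop 0] with t ht
    have h1 := (H.flux ht.le).2
    have ht' : 0 ≤ 1/Γ * (1/t) := by positivity
    have h2 := mul_le_mul_of_nonneg_left h1 ht'
    have h3 : 1/Γ * (1/t) * -(2 * Γ) = -(2 * (1/t)) := by field_simp
    have h4 : 0 ≤ 1/Γ * (Y + Γ) * (1/t) := by positivity
    rw [h3] at h2
    linarith
  · intro M hM hev
    obtain ⟨t0, ht0⟩ := eventually_atTop.1 (hev.and (eventually_gt_atTop 0))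
    have hD : ∀ t, t0 ≤ t → ∫ r in (0:ℝ)..t, fD S r ≤ M * Γ * t := by
      intro t ht
      obtain ⟨h1, h2⟩ := ht0 t ht
      have h3 := mul_le_mul_of_nonneg_left h1 (by positivity : 0 ≤ Γ * t)
      have h4 : Γ * t * (1/Γ * (1/t * ∫ s in (0:ℝ)..t, fD S s)) = ∫ s in (0:ℝ)..t, fD S s := by
        field_simp
      rw [h4] at h3
      linarith
    obtain ⟨k, hk⟩ := H.press hΓ hRa hPr hl
      (CR := 2 + Ra + Pr⁻¹ * (1/2) * (Y/2 + (1/Γ + 1)))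
      (CG := Pr⁻¹ * (Pr⁻¹ * ((2 * Y + 1) * (1/Γ + 1)) * (1 + 2 * Pr) + Pr * Ra^2 / 2 * Γ))
      (by positivity) (by positivity)
      (fun t ht => R_bound S hΓ hRa hPr (hY t ht) hY0)
      (fun t ht m hm => G_bound S hΓ hRa hPr hT0 ht (hY t ht) hY0 hm) (by positivity) hD
    refine ⟨1/Γ * k, ?_⟩
    filter_upwards [eventually_ge_atTop t0, eventually_ge_atTop 1] with t h1 h2
    obtain ⟨k1, k2⟩ := hk t h1 h2
    have ht : 0 < t := by linarith
    have aux : ∀ I : ℝ, |I| ≤ k * t → |1/Γ * (1/t * I)| ≤ 1/Γ * k := by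
      intro I hI
      rw [abs_mul, abs_of_pos hg, abs_mul, abs_of_pos (by positivity : 0 < 1/t)]
      apply mul_le_mul_of_nonneg_left _ hg.le
      rw [one_div, inv_mul_le_iff₀ ht]; linarith
    exact ⟨aux _ k1, aux _ k2⟩
  · filter_upwards [eventually_gt_atTop 0] with t ht
    have : 0 ≤ ∫ s in (0:ℝ)..t, fD S s :=
      intervalIntegral.integral_nonneg ht.le fun r hr => H.D0 r hr.1
    positivity
end

/-- enstrophy, long-time average bound. -/
theorem enstrophy_longtime_bound (Γ Ra Pr Ls : ℝ)
    (hΓ : 0 < Γ) (hRa : 0 < Ra) (hPr : 0 < Pr) (hLs : 0 < Ls)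
    (S : Sol Γ Ra Pr (ENNReal.ofReal Ls)) (hT0 : T0cond S) :
    ltavg Γ (fun t x1 => ∫ x2 in (0:ℝ)..1,
        (d1 (vort S) t x1 x2 ^ 2 + d2 (vort S) t x1 x2 ^ 2)) ≤
      Ls⁻¹ * |ltavg Γ (fun t x1 => S.p t x1 1 * d1 S.u1 t x1 1) +
              ltavg Γ (fun t x1 => S.p t x1 0 * d1 S.u1 t x1 0)| +
      Nu S * Ra ^ ((3:ℝ)/2) :=
  final_bound Γ Ra Pr Ls hΓ hRa hPr hLs S hT0

end RB
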